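/- arXiv:2105.14420 — 4 statements merged into one kernel-verified Lean document; each statement's English description precedes it below -/
import Mathlib

section
/- Let τ be a semistandard Young tableau of shape λ and weight μ. For every B ∈ X̊_{τ−[m]}, the fibre F_B = { A ∈ X̊_τ : A_{(m, μ_m−1)} = B } of the restriction map X̊_τ → X̊_{τ−[m]}, A ↦ A_{(m, μ_m−1)}, is a nonempty irreducible subset of the space of N×N complex matrices of dimension m − r in the Zariski topology. -/
open scoped BigOperators Classical

noncomputable section

namespace Gov

/-- Extend a vector of length `m` by zeros. -/
def ext {m : ℕ} (f : Fin m → ℕ) : ℕ → ℕ := fun r => if h : r < m then f ⟨r, h⟩ else 0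

/-- Offset of the `a`-th block: `μ_1 + ⋯ + μ_{a-1}`. -/
def off {m : ℕ} (μ : Fin m → ℕ) (a : Fin m) : ℕ :=
  ∑ j ∈ Finset.univ.filter (fun j : Fin m => (j : ℕ) < (a : ℕ)), μ j

/-- Total entry access for a square matrix (zero outside the index range). -/
def ent {N : ℕ} (A : Matrix (Fin N) (Fin N) ℂ) (i j : ℕ) : ℂ :=
  if h : i < N ∧ j < N then A ⟨i, h.1⟩ ⟨j, h.2⟩ else 0

/-- Entries of the Jordan matrix `J_μ`:  `J_μ e_a^b = e_a^{b-1}`. -/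
def Jent {m : ℕ} (μ : Fin m → ℕ) (i j : ℕ) : ℂ :=
  if ∃ a : Fin m, ∃ b : ℕ, b + 1 < μ a ∧ i = off μ a + b ∧ j = off μ a + b + 1 then 1 else 0

/-- Membership in the Mirković–Vybornov slice `T_μ`. -/
def inSlice {m N : ℕ} (μ : Fin m → ℕ) (A : Matrix (Fin N) (Fin N) ℂ) : Prop :=
  ∀ s a : Fin m, ∀ t b : ℕ, t < μ s → b < μ a →
    (t + 1 < μ s ∨ (t + 1 = μ s ∧ μ s ≤ b)) →
    ent A (off μ s + t) (off μ a + b) = Jent μ (off μ s + t) (off μ a + b)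

/-- Upper triangularity. -/
def upperTri {N : ℕ} (A : Matrix (Fin N) (Fin N) ℂ) : Prop :=
  ∀ i j : Fin N, (j : ℕ) < (i : ℕ) → A i j = 0

/-- The top-left `d × d` submatrix. -/
def corner {N : ℕ} (A : Matrix (Fin N) (Fin N) ℂ) (d : ℕ) : Matrix (Fin d) (Fin d) ℂ :=
  fun i j => ent A (i : ℕ) (j : ℕ)

/-- `A` is nilpotent with Jordan type `κ` (a partition with at most `rows` parts):
`rank A^k = Σ_r max(κ_r − k, 0)` for all `k ≥ 1`. -/
def hasType {n : ℕ} (A : Matrix (Fin n) (Fin n) ℂ) (rows : ℕ) (κ : ℕ → ℕ) : Prop :=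
  ∀ k : ℕ, 1 ≤ k → (A ^ k).rank = ∑ r ∈ Finset.range rows, (κ r - k)

/-- A semistandard Young tableau of shape `lam` and weight `μ`, both with at most `m` parts,
with entries in `{1, …, m}` (rows and columns are 0-based; `entry r c = 0` outside the shape). -/
structure Tableau (m : ℕ) (lam μ : Fin m → ℕ) where
  entry : ℕ → ℕ → ℕ
  zeros : ∀ r c : ℕ, ¬ c < ext lam r → entry r c = 0
  entry_pos : ∀ r c : ℕ, c < ext lam r → 1 ≤ entry r c
  entry_le : ∀ r c : ℕ, c < ext lam r → entry r c ≤ m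
  row_weak : ∀ r c c' : ℕ, c ≤ c' → c' < ext lam r → entry r c ≤ entry r c'
  col_strict : ∀ r r' c : ℕ, r < r' → c < ext lam r' → entry r c < entry r' c
  weight : ∀ i : Fin m,
    (∑ r ∈ Finset.range m,
      ((Finset.range (ext lam r)).filter fun c => entry r c = (i : ℕ) + 1).card) = μ i

/-- Row lengths of the shape `λ^{(i)}` of the tableau obtained from `T` by deleting all
entries `> i` (here `i` is 1-based). -/
def shapeRow {m : ℕ} {lam μ : Fin m → ℕ} (T : Tableau m lam μ) (i : ℕ) : ℕ → ℕ :=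
  fun r => ((Finset.range (ext lam r)).filter fun c => 1 ≤ T.entry r c ∧ T.entry r c ≤ i).card

/-- Row lengths of the shape `λ^{(i,k)}` of the tableau obtained from `T` by deleting all
entries `> i` and all but the leftmost `k` entries equal to `i` (here `i` is 1-based). -/
def shapeRowBox {m : ℕ} {lam μ : Fin m → ℕ} (T : Tableau m lam μ) (i k : ℕ) : ℕ → ℕ :=
  fun r => ((Finset.range (ext lam r)).filter fun c =>
    (1 ≤ T.entry r c ∧ T.entry r c < i) ∨ (T.entry r c = i ∧
      ((Finset.range c).filter fun c' => ∃ r' < m, T.entry r' c' = i).card < k)).card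

/-- The matrix variety `X̊_τ`. -/
def Xcirc {m : ℕ} (μ lam : Fin m → ℕ) (N : ℕ) (T : Tableau m lam μ) :
    Set (Matrix (Fin N) (Fin N) ℂ) :=
  { A | inSlice μ A ∧ upperTri A ∧
      ∀ i : Fin m, hasType (corner A (off μ i + μ i)) m (shapeRow T ((i : ℕ) + 1)) }

/-- The Zariski topology on `N × N` complex matrices: closed sets are common zero sets of
families of polynomials in the entries. -/
def mzar (N : ℕ) : TopologicalSpace (Matrix (Fin N) (Fin N) ℂ) :=
  TopologicalSpace.generateFrom
    { U | ∃ p : MvPolynomial (Fin N × Fin N) ℂ,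
        U = { A | MvPolynomial.eval (fun q => A q.1 q.2) p ≠ 0 } }

/-- Zariski closure. -/
def closureZ {N : ℕ} (S : Set (Matrix (Fin N) (Fin N) ℂ)) : Set (Matrix (Fin N) (Fin N) ℂ) :=
  letI := mzar N
  closure S

/-- Irreducibility for the Zariski topology. -/
def isIrreducibleZ {N : ℕ} (S : Set (Matrix (Fin N) (Fin N) ℂ)) : Prop :=
  letI := mzar N
  IsIrreducible S

/-- Irreducible components of a subset: maximal irreducible subsets. -/
def irrCompsZ {N : ℕ} (S : Set (Matrix (Fin N) (Fin N) ℂ)) :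
    Set (Set (Matrix (Fin N) (Fin N) ℂ)) :=
  { C | C ⊆ S ∧ isIrreducibleZ C ∧
      ∀ C', C' ⊆ S → isIrreducibleZ C' → C ⊆ C' → C' = C }

/-- Dimension of a subset: its Krull dimension as a topological space
(with the subspace Zariski topology). -/
def dimZ {N : ℕ} (S : Set (Matrix (Fin N) (Fin N) ℂ)) : WithBot ℕ∞ :=
  letI := mzar N
  topologicalKrullDim S


/-- `X̊_{τ−[m]}`: the matrix variety of the tableau obtained from `τ` by deleting its
rightmost entry equal to `m`, defined inside `(N−1) × (N−1)` matrices with respect to the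
weight `μ' = (μ_1, …, μ_{m−1}, μ_m − 1)`. -/
def XcircMinus {m : ℕ} (μ lam : Fin m → ℕ) (N : ℕ) (T : Tableau m lam μ)
    (last : Fin m) : Set (Matrix (Fin (N - 1)) (Fin (N - 1)) ℂ) :=
  { B | inSlice (Function.update μ last (μ last - 1)) B ∧ upperTri B ∧
      ∀ i : Fin m,
        hasType
          (corner B (off (Function.update μ last (μ last - 1)) i
            + Function.update μ last (μ last - 1) i)) m
          (if (i : ℕ) + 1 = m then shapeRowBox T m (μ last - 1)
           else shapeRow T ((i : ℕ) + 1)) }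

/-- The standard basis vector of `ℂ^n` supported at (0-based) position `i`. -/
def stdVec (n : ℕ) (i : ℕ) : Fin n → ℂ := fun j => if (j : ℕ) = i then 1 else 0

/-- `L = span(e_1^{μ_1}, …, e_{m−1}^{μ_{m−1}})`. -/
def Lspan {m : ℕ} (μ : Fin m → ℕ) (n : ℕ) : Submodule ℂ (Fin n → ℂ) :=
  Submodule.span ℂ
    { v | ∃ a : Fin m, (a : ℕ) + 1 < m ∧ v = stdVec n (off μ a + (μ a - 1)) }

/-- `S = (B^{l−1})^{-1}(Im B^{l})`. -/
def Ssub {n : ℕ} (B : Matrix (Fin n) (Fin n) ℂ) (l : ℕ) : Submodule ℂ (Fin n → ℂ) :=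
  Submodule.comap (Matrix.mulVecLin (B ^ (l - 1)))
    (LinearMap.range (Matrix.mulVecLin (B ^ l)))

/-! ### Irreducibility and dimension of line-cofinite sets -/

lemma isOpen_mzar_basic {N : ℕ} (p : MvPolynomial (Fin N × Fin N) ℂ) :
    @IsOpen _ (mzar N) {A | MvPolynomial.eval (fun q => A q.1 q.2) p ≠ 0} :=
  TopologicalSpace.isOpen_generateFrom_of_mem ⟨p, rfl⟩

lemma exists_basic_subset_of_isOpen_mzar {N : ℕ} {U : Set (Matrix (Fin N) (Fin N) ℂ)}
    (hU : @IsOpen _ (mzar N) U) :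
    ∀ A ∈ U, ∃ p : MvPolynomial (Fin N × Fin N) ℂ,
      MvPolynomial.eval (fun q => A q.1 q.2) p ≠ 0 ∧
      ∀ A', MvPolynomial.eval (fun q => A' q.1 q.2) p ≠ 0 → A' ∈ U := by
  induction hU with
  | basic s hs => obtain ⟨p, rfl⟩ := hs; exact fun A hA => ⟨p, hA, fun _ h => h⟩
  | univ => exact fun A _ => ⟨1, by simp, fun _ _ => trivial⟩
  | inter s t _ _ ihs iht =>
    rintro A ⟨hs, ht⟩
    obtain ⟨p, hp, hp'⟩ := ihs A hs
    obtain ⟨q, hq, hq'⟩ := iht A ht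
    refine ⟨p * q, by simp [hp, hq], fun A' h => ?_⟩
    rw [map_mul] at h
    exact ⟨hp' _ (left_ne_zero_of_mul h), hq' _ (right_ne_zero_of_mul h)⟩
  | sUnion S _ ih =>
    rintro A ⟨s, hs, hA⟩
    obtain ⟨p, hp, hp'⟩ := ih s hs A hA
    exact ⟨p, hp, fun A' h => ⟨s, hs, hp' A' h⟩⟩

lemma finite_zeros_on_line {σ : Type*} (p : MvPolynomial σ ℂ) (x y : σ → ℂ)
    (t₀ : ℂ) (h : MvPolynomial.eval (fun i => x i + t₀ * y i) p ≠ 0) :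
    {t : ℂ | MvPolynomial.eval (fun i => x i + t * y i) p = 0}.Finite := by
  let q : Polynomial ℂ :=
    MvPolynomial.aeval (fun i => Polynomial.C (x i) + Polynomial.X * Polynomial.C (y i)) p
  have hq (t : ℂ) : q.eval t = MvPolynomial.eval (fun i => x i + t * y i) p := by
    have : (Polynomial.aeval t).comp (MvPolynomial.aeval
        (fun i => Polynomial.C (x i) + Polynomial.X * Polynomial.C (y i))) =
        MvPolynomial.aeval (R := ℂ) (fun i => x i + t * y i) := by
      ext i; simpa using mul_comm _ _
    simpa [MvPolynomial.aeval_eq_eval, Polynomial.aeval_def, Polynomial.eval₂_eq_eval_map, q]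
      using DFunLike.congr_fun this p
  have hq0 : q ≠ 0 := by
    rintro h0
    exact h (by rw [← hq, h0, Polynomial.eval_zero])
  refine (q.roots.toFinset.finite_toSet).subset fun t ht => ?_
  simpa [hq0, hq] using ht

/-- A set meeting cofinitely every line through two of its points is preirreducible. -/
lemma isPreirreducible_of_line_cofinite {N : ℕ} {F : Set (Matrix (Fin N) (Fin N) ℂ)}
    (h : ∀ A ∈ F, ∀ A' ∈ F, {t : ℂ | A + t • (A' - A) ∉ F}.Finite) :
    @IsPreirreducible _ (mzar N) F := by
  rintro U V hU hV ⟨A, hA, hAU⟩ ⟨A', hA', hAV⟩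
  obtain ⟨p, hp, hp'⟩ := exists_basic_subset_of_isOpen_mzar hU A hAU
  obtain ⟨q, hq, hq'⟩ := exists_basic_subset_of_isOpen_mzar hV A' hAV
  have h1 := finite_zeros_on_line p (fun i => A i.1 i.2) (fun i => (A' - A) i.1 i.2) 0
    (by simpa using hp)
  have h2 := finite_zeros_on_line q (fun i => A i.1 i.2) (fun i => (A' - A) i.1 i.2) 1
    (by simpa using hq)
  obtain ⟨t, ht⟩ := ((h1.union h2).union (h A hA A' hA')).infinite_compl.nonempty
  simp only [Set.mem_compl_iff, Set.mem_union, Set.mem_ofPred_eq, not_or, not_not] at ht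
  exact ⟨A + t • (A' - A), ht.2, hp' _ (by simpa using ht.1.1), hq' _ (by simpa using ht.1.2)⟩

lemma exists_poly_linear {ι σ : Type*} [Fintype σ] (c : (σ → ℂ) →ₗ[ℂ] (ι → ℂ)) (a : ι → ℂ)
    (q : MvPolynomial ι ℂ) : ∃ p : MvPolynomial σ ℂ, ∀ x,
      MvPolynomial.eval x p = MvPolynomial.eval (c x + a) q := by
  refine ⟨MvPolynomial.aeval (fun i => ∑ s, MvPolynomial.C (c (Pi.single s 1) i) *
    MvPolynomial.X s + MvPolynomial.C (a i)) q, fun x => ?_⟩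
  have hx : c x + a = fun i => ∑ s, c (Pi.single s 1) i * x s + a i := by
    funext i
    conv_lhs => rw [LinearMap.pi_apply_eq_sum_univ c x]
    simp only [Pi.add_apply, Finset.sum_apply, Pi.smul_apply, smul_eq_mul, mul_comm]
    have hs (s : σ) : (fun j => if s = j then (1 : ℂ) else 0) = Pi.single s 1 := by
      funext j
      simp [Pi.single_apply, eq_comm]
    simp only [hs]
  have : (MvPolynomial.aeval x).comp (MvPolynomial.aeval (R := ℂ) (fun i =>
      ∑ s, MvPolynomial.C (c (Pi.single s 1) i) * MvPolynomial.X s + MvPolynomial.C (a i))) =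
      MvPolynomial.aeval (R := ℂ) (fun i => ∑ s, c (Pi.single s 1) i * x s + a i) := by
    ext i; simp
  rw [hx]
  simpa [MvPolynomial.aeval_eq_eval] using DFunLike.congr_fun this q

lemma dimZ_le_finrank {N : ℕ} {F : Set (Matrix (Fin N) (Fin N) ℂ)} (hne : F.Nonempty)
    (D : Submodule ℂ (Matrix (Fin N) (Fin N) ℂ))
    (h1 : ∀ A ∈ F, ∀ A' ∈ F, A' - A ∈ D) :
    dimZ F ≤ ((Module.finrank ℂ D : ℕ∞) : WithBot ℕ∞) := by
  obtain ⟨A₀, hA₀⟩ := hne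
  let b := Module.finBasis ℂ D
  let e := b.equivFun
  obtain ⟨c, hc⟩ := LinearMap.exists_leftInverse_of_injective D.subtype (by simp)
  let u : Matrix (Fin N) (Fin N) ℂ ≃ₗ[ℂ] (Fin N × Fin N → ℂ) := (LinearEquiv.curry ℂ ℂ _ _).symm
  have hu (A : Matrix (Fin N) (Fin N) ℂ) : u A = fun q => A q.1 q.2 := rfl
  let x : Matrix (Fin N) (Fin N) ℂ →ₗ[ℂ] (Fin (Module.finrank ℂ D) → ℂ) := e.toLinearMap ∘ₗ c
  have hx (A) (hA : A ∈ F) : A = A₀ + (e.symm (x (A - A₀)) : Matrix _ _ ℂ) := by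
    have : c (A - A₀) = ⟨A - A₀, h1 _ hA₀ _ hA⟩ :=
      DFunLike.congr_fun hc ⟨A - A₀, h1 _ hA₀ _ hA⟩
    simp [x, this]
  let _ := mzar N
  let g : F → PrimeSpectrum (MvPolynomial (Fin (Module.finrank ℂ D)) ℂ) :=
    fun A => MvPolynomial.pointToPoint (x (A.1 - A₀))
  have hg (A : F) (q) : q ∉ (g A).asIdeal ↔ MvPolynomial.eval (x (A.1 - A₀)) q ≠ 0 := by
    simp [g, MvPolynomial.pointToPoint, MvPolynomial.aeval_eq_eval]
  have hind : Topology.IsInducing g := by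
    constructor
    rw [PrimeSpectrum.isTopologicalBasis_basic_opens.eq_generateFrom, induced_generateFrom_eq]
    change TopologicalSpace.induced _ (mzar N) = _
    rw [mzar, induced_generateFrom_eq]
    congr 1
    ext U
    constructor
    · rintro ⟨_, ⟨p, rfl⟩, rfl⟩
      obtain ⟨q, hq⟩ := exists_poly_linear
        (u.toLinearMap ∘ₗ D.subtype ∘ₗ e.symm.toLinearMap) (u A₀) p
      refine ⟨_, ⟨q, rfl⟩, ?_⟩
      ext A
      simp only [Set.mem_preimage, SetLike.mem_coe, PrimeSpectrum.mem_basicOpen, hg, hq]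
      simp only [LinearMap.coe_comp, LinearEquiv.coe_coe, Function.comp_apply, ← map_add]
      rw [Submodule.subtype_apply, add_comm _ A₀, ← hx _ A.2]
      rfl
    · rintro ⟨_, ⟨q, rfl⟩, rfl⟩
      obtain ⟨p, hp⟩ := exists_poly_linear (x ∘ₗ u.symm.toLinearMap) (- x A₀) q
      refine ⟨_, ⟨p, rfl⟩, ?_⟩
      ext A
      simp only [Set.mem_preimage, SetLike.mem_coe, PrimeSpectrum.mem_basicOpen, hg,
        Set.mem_ofPred_eq, hp, ← hu]
      simp [sub_eq_add_neg]
  refine hind.topologicalKrullDim_le.trans ?_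
  rw [PrimeSpectrum.topologicalKrullDim_eq_ringKrullDim,
    MvPolynomial.ringKrullDim_of_isNoetherianRing]
  simp

lemma finrank_le_dimZ {N : ℕ} {F : Set (Matrix (Fin N) (Fin N) ℂ)} (hne : F.Nonempty)
    (D : Submodule ℂ (Matrix (Fin N) (Fin N) ℂ))
    (h1 : ∀ A ∈ F, ∀ A' ∈ F, A' - A ∈ D)
    (h2 : ∀ A ∈ F, ∀ X ∈ D, {t : ℂ | A + t • X ∉ F}.Finite) :
    ((Module.finrank ℂ D : ℕ∞) : WithBot ℕ∞) ≤ dimZ F := by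
  obtain ⟨A₀, hA₀⟩ := hne
  let b := Module.finBasis ℂ D
  let e := b.equivFun
  obtain ⟨c, hc⟩ := LinearMap.exists_leftInverse_of_injective D.subtype (by simp)
  let u : Matrix (Fin N) (Fin N) ℂ ≃ₗ[ℂ] (Fin N × Fin N → ℂ) := (LinearEquiv.curry ℂ ℂ _ _).symm
  have hu (A : Matrix (Fin N) (Fin N) ℂ) : u A = fun q => A q.1 q.2 := rfl
  let x : Matrix (Fin N) (Fin N) ℂ →ₗ[ℂ] (Fin (Module.finrank ℂ D) → ℂ) := e.toLinearMap ∘ₗ c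
  have hx (i) : x (b i) = Pi.single i 1 := by
    have : c (b i) = b i := DFunLike.congr_fun hc (b i)
    simp only [x, LinearMap.comp_apply, this]
    simp [e, Pi.single_apply, funext_iff, Finsupp.single_apply, eq_comm]
  let _ := mzar N
  let Z (k : ℕ) : Set F := {A | ∀ i : Fin (Module.finrank ℂ D), k ≤ i → x (A.1 - A₀) i = 0}
  have hZ0 (k : ℕ) : (⟨A₀, hA₀⟩ : F) ∈ Z k := fun i _ => by simp
  have hclosed (k : ℕ) : IsClosed (Z k) := by
    have : Z k = ⋂ (i : Fin (Module.finrank ℂ D)) (_ : k ≤ i), {A : F | x (A.1 - A₀) i = 0} := by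
      ext; simp [Z]
    rw [this]
    refine isClosed_iInter fun i => isClosed_iInter fun _ => ?_
    obtain ⟨p, hp⟩ := exists_poly_linear (x ∘ₗ u.symm.toLinearMap) (- x A₀) (MvPolynomial.X i)
    rw [← isOpen_compl_iff]
    convert (isOpen_mzar_basic p).preimage (continuous_subtype_val (p := (· ∈ F))) using 1
    ext A
    simp [hp, ← hu, sub_eq_add_neg]
  have hirr (k : ℕ) : IsIrreducible (Z k) := by
    refine ⟨⟨_, hZ0 k⟩, ?_⟩
    have := isPreirreducible_of_line_cofinite (F := Subtype.val '' Z k) ?_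
    · rintro U V hU hV ⟨A, hA, hAU⟩ ⟨A', hA', hAV⟩
      obtain ⟨U, hU', rfl⟩ := isOpen_induced_iff.1 hU
      obtain ⟨V, hV', rfl⟩ := isOpen_induced_iff.1 hV
      obtain ⟨_, ⟨X, hX, rfl⟩, hXU, hXV⟩ :=
        this U V hU' hV' ⟨A, ⟨A, hA, rfl⟩, hAU⟩ ⟨A', ⟨A', hA', rfl⟩, hAV⟩
      exact ⟨X, hX, hXU, hXV⟩
    · rintro _ ⟨A, hA, rfl⟩ _ ⟨A', hA', rfl⟩
      refine (h2 A A.2 _ (h1 A A.2 A' A'.2)).subset fun t ht => ?_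
      contrapose! ht
      simp only [Set.mem_ofPred_eq, not_not] at ht ⊢
      refine ⟨⟨_, ht⟩, fun i hi => ?_, rfl⟩
      have e1 := hA i hi
      have e2 := hA' i hi
      simp only [map_sub, map_add, map_smul, Pi.sub_apply, Pi.add_apply, Pi.smul_apply,
        smul_eq_mul] at e1 e2 ⊢
      linear_combination (1 - t) * e1 + t * e2
  let f (k : Fin (Module.finrank ℂ D + 1)) : TopologicalSpace.IrreducibleCloseds F :=
    ⟨Z k, hirr k, hclosed k⟩
  have hf : StrictMono f := by
    refine Fin.strictMono_iff_lt_succ.2 fun k => ?_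
    rw [← SetLike.coe_ssubset_coe]
    have hsub : Z (k.castSucc : ℕ) ⊆ Z (k.succ : ℕ) := fun A hA i hi =>
      hA i (le_trans (by simp) hi)
    refine (Set.ssubset_iff_of_subset hsub).2 ?_
    · obtain ⟨t, ht⟩ := ((h2 A₀ hA₀ (b k) (b k).2).union
        (Set.finite_singleton 0)).infinite_compl.nonempty
      simp only [Set.mem_compl_iff, Set.mem_union, Set.mem_ofPred_eq, not_or, not_not,
        Set.mem_singleton_iff] at ht
      refine ⟨⟨_, ht.1⟩, fun i hi => ?_, fun h => ht.2 ?_⟩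
      · have : i ≠ k := by rintro rfl; simp at hi
        simp [hx, this]
      · simpa [hx] using h k (by simp)
  exact Order.LTSeries.length_le_krullDim (LTSeries.mk _ f hf)

/-- A nonempty set of matrices contained in a translate of `D` and meeting cofinitely every
line with direction in `D` through one of its points is irreducible of dimension `dim D`. -/
lemma isIrreducibleZ_and_dimZ {N : ℕ} {F : Set (Matrix (Fin N) (Fin N) ℂ)} (hne : F.Nonempty)
    (D : Submodule ℂ (Matrix (Fin N) (Fin N) ℂ))
    (h1 : ∀ A ∈ F, ∀ A' ∈ F, A' - A ∈ D)
    (h2 : ∀ A ∈ F, ∀ X ∈ D, {t : ℂ | A + t • X ∉ F}.Finite) :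
    isIrreducibleZ F ∧ dimZ F = ((Module.finrank ℂ D : ℕ∞) : WithBot ℕ∞) :=
  ⟨⟨hne, isPreirreducible_of_line_cofinite fun A hA A' hA' => h2 A hA _ (h1 A hA A' hA')⟩,
    (dimZ_le_finrank hne D h1).antisymm (finrank_le_dimZ hne D h1 h2)⟩

/-! ### Bordered matrices and ranks -/

/-- The matrix `[B v; 0 0]`. -/
def bordered {n : ℕ} (B : Matrix (Fin n) (Fin n) ℂ) (v : Fin n → ℂ) :
    Matrix (Fin (n + 1)) (Fin (n + 1)) ℂ :=
  Fin.snoc (α := fun _ => Fin (n + 1) → ℂ)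
    (fun i => Fin.snoc (α := fun _ => ℂ) (B i) (v i)) 0

section Bordered

variable {n : ℕ} (B B' : Matrix (Fin n) (Fin n) ℂ) (v w : Fin n → ℂ)

@[simp] lemma bordered_castSucc_castSucc (i j : Fin n) :
    bordered B v i.castSucc j.castSucc = B i j := by
  simp [bordered]

@[simp] lemma bordered_castSucc_last (i : Fin n) :
    bordered B v i.castSucc (Fin.last n) = v i := by
  simp [bordered]

@[simp] lemma bordered_last (j : Fin (n + 1)) : bordered B v (Fin.last n) j = 0 := by
  simp [bordered]

lemma bordered_mul : bordered B v * bordered B' w = bordered (B * B') (B.mulVec w) := by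
  ext i j
  rw [Matrix.mul_apply, Fin.sum_univ_castSucc]
  refine Fin.lastCases ?_ (fun i => ?_) i <;> refine Fin.lastCases ?_ (fun j => ?_) j <;>
    simp [Matrix.mul_apply, Matrix.mulVec, dotProduct]

lemma bordered_pow (k : ℕ) :
    bordered B v ^ (k + 1) = bordered (B ^ (k + 1)) ((B ^ k).mulVec v) := by
  induction k with
  | zero => simp
  | succ k ih => rw [pow_succ', ih, bordered_mul, ← pow_succ', Matrix.mulVec_mulVec, ← pow_succ']

lemma bordered_add_smul (t : ℂ) :
    bordered B (v + t • w) = bordered B v + t • bordered 0 w := by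
  ext i j
  refine Fin.lastCases ?_ (fun i => ?_) i <;> refine Fin.lastCases ?_ (fun j => ?_) j <;> simp

variable (n) in
/-- Placing a vector in the last column, above a zero, as a linear map. -/
def lastColumn : (Fin n → ℂ) →ₗ[ℂ] Matrix (Fin (n + 1)) (Fin (n + 1)) ℂ where
  toFun := bordered 0
  map_add' v w := by simpa using bordered_add_smul 0 v w 1
  map_smul' t w := by
    ext i j
    refine Fin.lastCases ?_ (fun i => ?_) i <;> refine Fin.lastCases ?_ (fun j => ?_) j <;> simp

lemma lastColumn_injective : Function.Injective (lastColumn n) := fun v w h => by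
  funext i
  simpa [lastColumn] using congr_fun₂ h i.castSucc (Fin.last n)

/-- Extension of a vector by zero along an injection of index sets. -/
abbrev extendZero {ι η : Type*} (s : ι → η) : (ι → ℂ) →ₗ[ℂ] (η → ℂ) :=
  Function.ExtendByZero.linearMap ℂ s

lemma extendZero_apply {ι η : Type*} {s : ι → η} (hs : Function.Injective s) (x : ι → ℂ) (i : ι) :
    extendZero s x (s i) = x i := by
  rw [Function.ExtendByZero.linearMap_apply, hs.extend_apply]

lemma extendZero_of_notMem {ι η : Type*} {s : ι → η} (x : ι → ℂ) {i : η}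
    (hi : i ∉ Set.range s) : extendZero s x i = 0 := by
  rw [Function.ExtendByZero.linearMap_apply, Function.extend_apply' _ _ _ hi, Pi.zero_apply]

lemma extendZero_injective {ι η : Type*} {s : ι → η} (hs : Function.Injective s) :
    Function.Injective (extendZero s) := fun x y h => by
  funext i
  rw [← extendZero_apply hs x, h, extendZero_apply hs]

lemma rank_bordered :
    (bordered B w).rank =
      Module.finrank ℂ (LinearMap.range B.mulVecLin ⊔ Submodule.span ℂ {w} : Submodule ℂ _) := by
  rw [(Submodule.equivMapOfInjective _
      (extendZero_injective (Fin.castSucc_injective n)) _).finrank_eq,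
    Matrix.rank_eq_finrank_span_cols, Matrix.range_mulVecLin, Submodule.map_sup,
    Submodule.map_span, Submodule.map_span, ← Submodule.span_union]
  have h1 (j : Fin n) : (bordered B w).col j.castSucc = extendZero Fin.castSucc (B.col j) := by
    funext i
    refine Fin.lastCases ?_ (fun i => ?_) i
    · simp
    · simp [extendZero_apply (Fin.castSucc_injective n)]
  have h2 : (bordered B w).col (Fin.last n) = extendZero Fin.castSucc w := by
    funext i
    refine Fin.lastCases ?_ (fun i => ?_) i
    · simp
    · simp [extendZero_apply (Fin.castSucc_injective n)]
  have h3 : Set.range (bordered B w).col =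
      extendZero Fin.castSucc '' Set.range B.col ∪ extendZero Fin.castSucc '' {w} := by
    ext x
    simp only [Set.mem_range, Fin.exists_fin_succ', h1, h2, Set.mem_union, Set.mem_image,
      Set.mem_singleton_iff, exists_exists_eq_and, exists_eq_left]
  rw [h3]

end Bordered

lemma finrank_sup_span_singleton {V : Type*} [AddCommGroup V] [Module ℂ V] [FiniteDimensional ℂ V]
    (K : Submodule ℂ V) (w : V) :
    Module.finrank ℂ (K ⊔ Submodule.span ℂ {w} : Submodule ℂ V) =
      Module.finrank ℂ K + if w ∈ K then 0 else 1 := by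
  split_ifs with h
  · rw [sup_eq_left.2 (by simpa using h), add_zero]
  · exact Submodule.finrank_sup_span_singleton h

lemma finrank_comap_of_le_range {V W : Type*} [AddCommGroup V] [Module ℂ V]
    [FiniteDimensional ℂ V] [AddCommGroup W] [Module ℂ W] (f : V →ₗ[ℂ] W) {K : Submodule ℂ W}
    (hK : K ≤ LinearMap.range f) :
    Module.finrank ℂ (K.comap f) = Module.finrank ℂ K + Module.finrank ℂ (LinearMap.ker f) := by
  have h := LinearMap.finrank_range_add_finrank_ker (f.domRestrict (K.comap f))
  rw [LinearMap.range_domRestrict, Submodule.map_comap_eq_of_le hK, LinearMap.ker_domRestrict] at h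
  rw [← h, (Submodule.comapSubtypeEquivOfLe (LinearMap.ker_le_comap f)).finrank_eq]

lemma range_pow_succ_le {n : ℕ} (B : Matrix (Fin n) (Fin n) ℂ) (k : ℕ) :
    LinearMap.range (B ^ (k + 1)).mulVecLin ≤ LinearMap.range (B ^ k).mulVecLin := by
  rw [pow_succ, Matrix.mulVecLin_mul]
  exact LinearMap.range_comp_le_range _ _

lemma finrank_Ssub_succ {n : ℕ} (B : Matrix (Fin n) (Fin n) ℂ) (k : ℕ) :
    Module.finrank ℂ (Ssub B (k + 1)) + (B ^ k).rank = n + (B ^ (k + 1)).rank := by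
  have h := LinearMap.finrank_range_add_finrank_ker (B ^ k).mulVecLin
  rw [Module.finrank_fin_fun] at h
  rw [Ssub, Nat.add_sub_cancel, finrank_comap_of_le_range _ (range_pow_succ_le B k)]
  simp only [Matrix.rank]
  omega

lemma mem_Ssub_succ {n : ℕ} {B : Matrix (Fin n) (Fin n) ℂ} {k : ℕ} {v : Fin n → ℂ} :
    v ∈ Ssub B (k + 1) ↔ (B ^ k).mulVec v ∈ LinearMap.range (B ^ (k + 1)).mulVecLin := Iff.rfl

lemma Ssub_succ_mono {n : ℕ} (B : Matrix (Fin n) (Fin n) ℂ) :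
    Monotone fun k => Ssub B (k + 1) := by
  refine monotone_nat_of_le_succ fun k v hv => ?_
  obtain ⟨x, hx⟩ := mem_Ssub_succ.1 hv
  refine mem_Ssub_succ.2 ⟨x, ?_⟩
  rw [Matrix.mulVecLin_apply] at hx ⊢
  rw [pow_succ', ← Matrix.mulVec_mulVec, hx, Matrix.mulVec_mulVec, ← pow_succ']

lemma range_le_Ssub_succ {n : ℕ} (B : Matrix (Fin n) (Fin n) ℂ) (k : ℕ) :
    LinearMap.range B.mulVecLin ≤ Ssub B (k + 1) := by
  refine le_trans ?_ (Ssub_succ_mono B (Nat.zero_le k))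
  rintro _ ⟨x, rfl⟩
  exact mem_Ssub_succ.2 ⟨x, by simp⟩

lemma ker_le_Ssub_succ {n : ℕ} (B : Matrix (Fin n) (Fin n) ℂ) (k : ℕ) :
    LinearMap.ker (B ^ k).mulVecLin ≤ Ssub B (k + 1) := fun v hv => by
  rw [mem_Ssub_succ, ← Matrix.mulVecLin_apply, LinearMap.mem_ker.1 hv]
  exact Submodule.zero_mem _

lemma rank_bordered_pow {n : ℕ} (B : Matrix (Fin n) (Fin n) ℂ) (v : Fin n → ℂ) (k : ℕ) :
    (bordered B v ^ (k + 1)).rank =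
      (B ^ (k + 1)).rank + if v ∈ Ssub B (k + 1) then 0 else 1 := by
  rw [bordered_pow, rank_bordered, finrank_sup_span_singleton]
  rfl

lemma upperTri_pow_last {n : ℕ} {M : Matrix (Fin (n + 1)) (Fin (n + 1)) ℂ} (hM : upperTri M)
    (k : ℕ) : (M ^ k) (Fin.last n) (Fin.last n) = M (Fin.last n) (Fin.last n) ^ k := by
  induction k with
  | zero => simp
  | succ k ih =>
    rw [pow_succ', Matrix.mul_apply, Finset.sum_eq_single (Fin.last n), ih, pow_succ']
    · intro i _ hi
      rw [hM _ _ (Fin.lt_last_iff_ne_last.2 hi), zero_mul]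
    · simp

lemma upperTri_last_row {n : ℕ} {M : Matrix (Fin (n + 1)) (Fin (n + 1)) ℂ} (hM : upperTri M)
    {k : ℕ} (hk : (M ^ k).rank = 0) (j : Fin (n + 1)) : M (Fin.last n) j = 0 := by
  by_cases hj : j = Fin.last n
  · have h0 : (M ^ k).mulVecLin = 0 := by
      rw [← LinearMap.range_eq_bot, ← Submodule.finrank_eq_zero]
      exact hk
    have h1 : (M ^ k) (Fin.last n) (Fin.last n) = 0 := by
      simpa using congr_fun (DFunLike.congr_fun h0 (Pi.single (Fin.last n) 1)) (Fin.last n)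
    rw [upperTri_pow_last hM] at h1
    rw [hj]
    exact eq_zero_of_pow_eq_zero h1
  · exact hM _ _ (Fin.lt_last_iff_ne_last.2 hj)

lemma corner_apply {n d : ℕ} (h : d ≤ n) (B : Matrix (Fin n) (Fin n) ℂ) (i j : Fin d) :
    corner B d i j = B (Fin.castLE h i) (Fin.castLE h j) := by
  rw [corner, ent, dif_pos ⟨by omega, by omega⟩]
  rfl

lemma mulVec_extendZero_castLE {n d : ℕ} (h : d ≤ n) {B : Matrix (Fin n) (Fin n) ℂ}
    (hB : upperTri B) (x : Fin d → ℂ) :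
    B.mulVec (extendZero (Fin.castLE h) x) =
      extendZero (Fin.castLE h) ((corner B d).mulVec x) := by
  have hinj : Function.Injective (Fin.castLE h) := Fin.castLE_injective h
  funext i
  rw [Matrix.mulVec, dotProduct, ← Fintype.sum_of_injective _ hinj
    (fun j => B i (Fin.castLE h j) * x j) _ (fun j hj => by rw [extendZero_of_notMem _ hj, mul_zero])
    (fun j => by rw [extendZero_apply hinj])]
  by_cases hi : i ∈ Set.range (Fin.castLE h)
  · obtain ⟨i, rfl⟩ := hi
    rw [extendZero_apply hinj, Matrix.mulVec, dotProduct]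
    exact Finset.sum_congr rfl fun j _ => by rw [corner_apply h]
  · rw [extendZero_of_notMem _ hi]
    refine Finset.sum_eq_zero fun j _ => ?_
    have : d ≤ (i : ℕ) := by
      by_contra hlt
      exact hi ⟨⟨i, by omega⟩, rfl⟩
    rw [hB _ _ (by simp; omega), zero_mul]

lemma exists_mulVec_pow_eq_of_rank_corner {n d : ℕ} (h : d ≤ n) {B : Matrix (Fin n) (Fin n) ℂ}
    (hB : upperTri B) (k : ℕ) (hk : (B ^ k).rank = (corner B d ^ k).rank) (w : Fin n → ℂ) :
    ∃ x : Fin d → ℂ, (B ^ k).mulVec w = (B ^ k).mulVec (extendZero (Fin.castLE h) x) := by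
  have hpow (x : Fin d → ℂ) : (B ^ k).mulVec (extendZero (Fin.castLE h) x) =
      extendZero (Fin.castLE h) ((corner B d ^ k).mulVec x) := by
    clear hk
    induction k with
    | zero => simp
    | succ k ih =>
      rw [pow_succ', pow_succ', ← Matrix.mulVec_mulVec, ih, mulVec_extendZero_castLE h hB,
        Matrix.mulVec_mulVec]
  have hle : (LinearMap.range (corner B d ^ k).mulVecLin).map (extendZero (Fin.castLE h)) ≤
      LinearMap.range (B ^ k).mulVecLin := by
    rintro _ ⟨_, ⟨x, rfl⟩, rfl⟩
    exact ⟨extendZero (Fin.castLE h) x, hpow x⟩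
  have heq := Submodule.eq_of_le_of_finrank_eq hle (by
    rw [← (Submodule.equivMapOfInjective _
      (extendZero_injective (Fin.castLE_injective h)) _).finrank_eq]
    exact hk.symm)
  obtain ⟨_, ⟨x, rfl⟩, hx⟩ := heq.ge ⟨w, rfl⟩
  exact ⟨x, by rw [hpow]; exact hx.symm⟩

/-! ### Blocks and the slice -/

section Blocks

variable {m : ℕ} (μ : Fin m → ℕ)

lemma off_zero (h : 0 < m) : off μ ⟨0, h⟩ = 0 := by simp [off]

lemma off_succ {k : ℕ} (h : k + 1 < m) :
    off μ ⟨k + 1, h⟩ = off μ ⟨k, by omega⟩ + μ ⟨k, by omega⟩ := by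
  have : Finset.univ.filter (fun j : Fin m => (j : ℕ) < k + 1) =
      insert ⟨k, by omega⟩ (Finset.univ.filter (fun j : Fin m => (j : ℕ) < k)) := by
    ext j
    simp only [Finset.mem_filter_univ, Finset.mem_insert, Fin.ext_iff]
    omega
  simp only [off]
  rw [this, Finset.sum_insert (by simp), add_comm]

lemma off_last {ℓ : Fin m} (hℓ : (ℓ : ℕ) + 1 = m) : off μ ℓ + μ ℓ = ∑ j, μ j := by
  have : (Finset.univ : Finset (Fin m)) =
      insert ℓ (Finset.univ.filter (fun j : Fin m => (j : ℕ) < (ℓ : ℕ))) := by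
    ext j
    simp only [Finset.mem_univ, Finset.mem_insert, Finset.mem_filter_univ, Fin.ext_iff, true_iff]
    omega
  conv_rhs => rw [this]
  rw [Finset.sum_insert (by simp), add_comm, off]

lemma off_add_le {s a : Fin m} (h : s < a) : off μ s + μ s ≤ off μ a := by
  rw [off, add_comm, ← Finset.sum_insert (by simp)]
  refine Finset.sum_le_sum_of_subset fun j hj => ?_
  simp only [Finset.mem_insert, Finset.mem_filter_univ] at hj ⊢
  rcases hj with rfl | hj
  · exact h
  · exact hj.trans h

variable {μ}

lemma block_unique {s a : Fin m} {t b : ℕ} (ht : t < μ s) (hb : b < μ a)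
    (h : off μ s + t = off μ a + b) : s = a ∧ t = b := by
  rcases lt_trichotomy s a with hsa | rfl | hsa
  · have := off_add_le μ hsa; omega
  · exact ⟨rfl, by omega⟩
  · have := off_add_le μ hsa; omega

lemma exists_block {i : ℕ} (hi : i < ∑ j, μ j) :
    ∃ s : Fin m, ∃ t < μ s, i = off μ s + t := by
  have key : ∀ k (hk : k < m), i < off μ ⟨k, hk⟩ + μ ⟨k, hk⟩ →
      ∃ s : Fin m, ∃ t < μ s, i = off μ s + t := by
    intro k
    induction k with
    | zero =>
      exact fun hk h => ⟨⟨0, hk⟩, i, by rwa [off_zero, zero_add] at h, by rw [off_zero, zero_add]⟩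
    | succ k ih =>
      intro hk h
      by_cases hlt : i < off μ ⟨k + 1, hk⟩
      · exact ih (by omega) (by rwa [off_succ] at hlt)
      · exact ⟨⟨k + 1, hk⟩, i - off μ ⟨k + 1, hk⟩, by omega, by omega⟩
  have hm : 0 < m := by
    rcases Nat.eq_zero_or_pos m with rfl | h
    · simp at hi
    · exact h
  exact key (m - 1) (by omega) (by rwa [off_last μ (by simp; omega)])

lemma Jent_block {s a : Fin m} {t b : ℕ} (ht : t < μ s) (hb : b < μ a) :
    Jent μ (off μ s + t) (off μ a + b) = if s = a ∧ b = t + 1 then 1 else 0 := by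
  rw [Jent]
  refine if_congr ⟨?_, ?_⟩ rfl rfl
  · rintro ⟨c, d, hd, h1, h2⟩
    obtain ⟨rfl, rfl⟩ := block_unique ht (by omega) h1
    obtain ⟨rfl, rfl⟩ := block_unique hb hd h2
    exact ⟨rfl, rfl⟩
  · rintro ⟨rfl, rfl⟩
    exact ⟨s, t, hb, rfl, rfl⟩

lemma off_update {ℓ : Fin m} (hℓ : (ℓ : ℕ) + 1 = m) (x : ℕ) (a : Fin m) :
    off (Function.update μ ℓ x) a = off μ a := by
  refine Finset.sum_congr rfl fun j hj => Function.update_of_ne ?_ _ _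
  rintro rfl
  have := (Finset.mem_filter.1 hj).2
  omega

lemma mem_Lspan_iff {n : ℕ} {ℓ : Fin m} (hℓ : (ℓ : ℕ) + 1 = m) (hμpos : ∀ i, 1 ≤ μ i)
    (hn : n + 1 = ∑ j, μ j) {u : Fin n → ℂ} :
    u ∈ Lspan μ n ↔ ∀ (i : Fin n) (s : Fin m) (t : ℕ), t + 1 < μ s → (i : ℕ) = off μ s + t →
      u i = 0 := by
  constructor
  · intro hu i s t ht hi
    induction hu using Submodule.span_induction with
    | mem v hv =>
      obtain ⟨a, -, rfl⟩ := hv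
      rw [stdVec, if_neg]
      intro h
      have := hμpos a
      obtain ⟨rfl, rfl⟩ := block_unique (μ := μ) (by omega) (by omega) (hi.symm.trans h)
      omega
    | zero => rfl
    | add v w _ _ hv hw => rw [Pi.add_apply, hv, hw, add_zero]
    | smul c v _ hv => rw [Pi.smul_apply, hv, smul_zero]
  · intro h
    have hu : u = ∑ i, u i • stdVec n i := by
      funext j
      simp [stdVec, Fin.val_inj]
    rw [hu]
    refine Submodule.sum_mem _ fun i _ => ?_
    obtain ⟨s, t, ht, hi⟩ := exists_block (μ := μ) (i := i) (by omega)
    by_cases ht' : t + 1 < μ s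
    · rw [h i s t ht' hi, zero_smul]
      exact Submodule.zero_mem _
    · refine Submodule.smul_mem _ _ (Submodule.subset_span ⟨s, ?_, ?_⟩)
      · by_contra hs
        have : s = ℓ := Fin.ext (by omega)
        subst this
        have := off_last μ hℓ
        omega
      · rw [hi]
        congr 2
        omega

lemma finrank_Lspan {n : ℕ} {ℓ : Fin m} (hℓ : (ℓ : ℕ) + 1 = m) (hμpos : ∀ i, 1 ≤ μ i)
    (hn : n + 1 = ∑ j, μ j) : Module.finrank ℂ (Lspan μ n) = m - 1 := by
  have hle : m - 1 ≤ m := Nat.sub_le m 1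
  have hlt (a : Fin (m - 1)) : off μ (a.castLE hle) + (μ (a.castLE hle) - 1) < n := by
    have h1 := off_add_le μ (s := a.castLE hle) (a := ℓ)
      (Fin.lt_def.2 (by rw [Fin.val_castLE]; omega))
    have h2 := off_last μ hℓ
    have h3 := hμpos ℓ
    have h4 := hμpos (a.castLE hle)
    omega
  let g (a : Fin (m - 1)) : Fin n := ⟨_, hlt a⟩
  have hg : Function.Injective g := fun a b hab => by
    have h1 := hμpos (a.castLE hle)
    have h2 := hμpos (b.castLE hle)
    exact Fin.castLE_injective hle
      (block_unique (μ := μ) (by omega) (by omega) (Fin.ext_iff.1 hab)).1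
  have hstd (i : Fin n) : stdVec n i = Pi.basisFun ℂ (Fin n) i := by
    funext j
    simp [stdVec, Pi.single_apply, Fin.val_inj]
  have hset : {v | ∃ a : Fin m, (a : ℕ) + 1 < m ∧ v = stdVec n (off μ a + (μ a - 1))} =
      Set.range (Pi.basisFun ℂ (Fin n) ∘ g) := by
    ext v
    constructor
    · rintro ⟨a, ha, rfl⟩
      exact ⟨⟨a, by omega⟩, (hstd _).symm⟩
    · rintro ⟨a, rfl⟩
      exact ⟨a.castLE hle, by rw [Fin.val_castLE]; omega, (hstd _).symm⟩
  rw [Lspan, hset, finrank_span_eq_card ((Pi.basisFun ℂ (Fin n)).linearIndependent.comp g hg),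
    Fintype.card_fin]

/-- The entries which the slice condition for the shortened weight, together with the vanishing
of the last row, imposes on a matrix. -/
lemma entry_of_inSlice_update {n : ℕ} {ℓ : Fin m} (hℓ : (ℓ : ℕ) + 1 = m)
    (hn : n + 1 = ∑ j, μ j) {B : Matrix (Fin n) (Fin n) ℂ}
    (hB : inSlice (Function.update μ ℓ (μ ℓ - 1)) B)
    (hlast : ∀ i : Fin n, (i : ℕ) + 1 = n → ∀ j, B i j = 0)
    {i j : Fin n} {s a : Fin m} {t b : ℕ} (ht : t < μ s) (hb : b < μ a)
    (hi : (i : ℕ) = off μ s + t) (hj : (j : ℕ) = off μ a + b)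
    (h : t + 1 < μ s ∨ (t + 1 = μ s ∧ μ s ≤ b)) :
    B i j = if s = a ∧ b = t + 1 then 1 else 0 := by
  have hsum := off_last μ hℓ
  have hb' : b < Function.update μ ℓ (μ ℓ - 1) a := by
    rcases eq_or_ne a ℓ with rfl | ha
    · rw [Function.update_self]; omega
    · rwa [Function.update_of_ne ha]
  have ht' : t < Function.update μ ℓ (μ ℓ - 1) s := by
    rcases eq_or_ne s ℓ with rfl | hs
    · rw [Function.update_self]; omega
    · rwa [Function.update_of_ne hs]
  by_cases hrow : (i : ℕ) + 1 = n
  · rw [hlast i hrow, if_neg]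
    rintro ⟨rfl, rfl⟩
    omega
  have := hB s a t b ht' hb' (by
    rcases eq_or_ne s ℓ with rfl | hs
    · rw [Function.update_self]; omega
    · rwa [Function.update_of_ne hs])
  rw [Jent_block ht' hb', off_update hℓ, off_update hℓ, ← hi, ← hj, ent,
    dif_pos ⟨i.2, j.2⟩] at this
  exact this

/-- The part of the last column of a matrix in the slice which is prescribed by `J_μ`. -/
def baseVec (μ : Fin m → ℕ) (ℓ : Fin m) (n : ℕ) : Fin n → ℂ :=
  fun i => if (i : ℕ) + 1 = n ∧ 2 ≤ μ ℓ then 1 else 0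

lemma inSlice_bordered_iff {n : ℕ} {ℓ : Fin m} (hℓ : (ℓ : ℕ) + 1 = m)
    (hμmono : ∀ i j : Fin m, i ≤ j → μ j ≤ μ i) (hμpos : ∀ i, 1 ≤ μ i)
    (hn : n + 1 = ∑ j, μ j) {B : Matrix (Fin n) (Fin n) ℂ}
    (hB : inSlice (Function.update μ ℓ (μ ℓ - 1)) B)
    (hlast : ∀ i : Fin n, (i : ℕ) + 1 = n → ∀ j, B i j = 0) (v : Fin n → ℂ) :
    inSlice μ (bordered B v) ↔ v - baseVec μ ℓ n ∈ Lspan μ n := by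
  have hsum := off_last μ hℓ
  have hposℓ := hμpos ℓ
  have hbase (i : Fin n) (s : Fin m) (t : ℕ) (ht : t < μ s) (hi : (i : ℕ) = off μ s + t) :
      baseVec μ ℓ n i = if s = ℓ ∧ μ ℓ - 1 = t + 1 then 1 else 0 := by
    refine if_congr ⟨fun h => ?_, ?_⟩ rfl rfl
    · have := block_unique (μ := μ) (s := s) (a := ℓ) (t := t) (b := μ ℓ - 2) ht (by omega)
        (by omega)
      omega
    · rintro ⟨rfl, h⟩
      omega
  have hcol : n = off μ ℓ + (μ ℓ - 1) := by omega
  rw [mem_Lspan_iff hℓ hμpos hn]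
  constructor
  · intro h i s t ht hi
    have := h s ℓ t (μ ℓ - 1) (by omega) (by omega) (Or.inl ht)
    rw [Jent_block (by omega) (by omega), ← hi, ← hcol, ent, dif_pos ⟨by omega, by omega⟩] at this
    rw [Pi.sub_apply, hbase i s t (by omega) hi, ← this, sub_eq_zero]
    exact (bordered_castSucc_last B v i).symm
  · intro h s a t b ht hb hcond
    have hs : off μ s + t < n + 1 := by
      rcases (show s ≤ ℓ from Fin.le_def.2 (by omega)).lt_or_eq with h' | rfl
      · have := off_add_le μ h'; omega
      · omega
    have ha : off μ a + b < n + 1 := by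
      rcases (show a ≤ ℓ from Fin.le_def.2 (by omega)).lt_or_eq with h' | rfl
      · have := off_add_le μ h'; omega
      · omega
    rw [ent, dif_pos ⟨hs, ha⟩, Jent_block ht hb]
    rcases Nat.lt_succ_iff_lt_or_eq.1 hs with hs' | hs'
    · rcases Nat.lt_succ_iff_lt_or_eq.1 ha with ha' | ha'
      · rw [← entry_of_inSlice_update hℓ hn hB hlast (i := ⟨_, hs'⟩) (j := ⟨_, ha'⟩) ht hb
          rfl rfl hcond]
        exact bordered_castSucc_castSucc B v ⟨_, hs'⟩ ⟨_, ha'⟩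
      · obtain ⟨rfl, rfl⟩ := block_unique (μ := μ) hb (by omega) (ha'.trans hcol)
        have hts : t + 1 < μ s := by
          have := hμmono s a (Fin.le_def.2 (by omega))
          omega
        have h0 := h ⟨_, hs'⟩ s t hts rfl
        rw [Pi.sub_apply, hbase _ s t ht rfl, sub_eq_zero] at h0
        rw [← h0]
        rw [show (⟨_, ha⟩ : Fin (n + 1)) = Fin.last n from Fin.ext ha']
        exact bordered_castSucc_last B v ⟨_, hs'⟩
    · obtain ⟨rfl, rfl⟩ := block_unique (μ := μ) ht (by omega) (hs'.trans hcol)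
      rw [if_neg (by rintro ⟨rfl, rfl⟩; omega)]
      rw [show (⟨_, hs⟩ : Fin (n + 1)) = Fin.last n from Fin.ext hs']
      exact bordered_last B v ⟨_, ha⟩

lemma single_mem_Lspan_sup_range {n : ℕ} {ℓ : Fin m} (hℓ : (ℓ : ℕ) + 1 = m)
    (hμpos : ∀ i, 1 ≤ μ i)
    (hn : n + 1 = ∑ j, μ j) {B : Matrix (Fin n) (Fin n) ℂ}
    (hB : inSlice (Function.update μ ℓ (μ ℓ - 1)) B)
    (hlast : ∀ i : Fin n, (i : ℕ) + 1 = n → ∀ j, B i j = 0) (i : Fin n)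
    (hi : (i : ℕ) + 1 < n ∨ μ ℓ = 1) :
    (Pi.single i 1 : Fin n → ℂ) ∈ Lspan μ n ⊔ LinearMap.range B.mulVecLin := by
  have hsum := off_last μ hℓ
  obtain ⟨s, t, ht, hst⟩ := exists_block (μ := μ) (i := i) (by omega)
  by_cases ht' : t + 1 < μ s
  · have hj : (i : ℕ) + 1 < n := by
      rcases hi with hi | hi
      · exact hi
      · rcases (show s ≤ ℓ from Fin.le_def.2 (by omega)).lt_or_eq with h' | rfl
        · have := off_add_le μ h'; omega
        · omega
    rw [show (Pi.single i 1 : Fin n → ℂ) = (Pi.single i 1 - B.mulVecLin (Pi.single ⟨_, hj⟩ 1)) +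
      B.mulVecLin (Pi.single ⟨_, hj⟩ 1) by abel]
    refine Submodule.add_mem_sup ((mem_Lspan_iff hℓ hμpos hn).2 ?_) ⟨_, rfl⟩
    intro i' s' t' ht'' hi'
    have := entry_of_inSlice_update hℓ hn hB hlast (i := i') (j := ⟨_, hj⟩) (s := s') (a := s)
      (t := t') (b := t + 1) (by omega) ht' hi' (by simp only; omega) (Or.inl ht'')
    simp only [Matrix.mulVecLin_apply, Matrix.mulVec_single_one, Pi.sub_apply, Matrix.col_apply,
      this, Pi.single_apply]
    rw [sub_eq_zero]
    refine if_congr ⟨?_, ?_⟩ rfl rfl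
    · rintro rfl
      obtain ⟨rfl, rfl⟩ := block_unique (μ := μ) ht (by omega) (hst.symm.trans hi')
      exact ⟨rfl, rfl⟩
    · rintro ⟨rfl, h⟩
      exact Fin.ext (by omega)
  · refine Submodule.mem_sup_left ((mem_Lspan_iff hℓ hμpos hn).2 fun i' s' t' ht'' hi' => ?_)
    rw [Pi.single_apply, if_neg]
    rintro rfl
    obtain ⟨rfl, rfl⟩ := block_unique (μ := μ) ht (by omega) (hst.symm.trans hi')
    omega

end Blocks

/-! ### Shapes of truncated tableaux -/

section Shapes

variable {m : ℕ} {lam μ : Fin m → ℕ} (T : Tableau m lam μ)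

lemma ext_antitone (hlam : ∀ i j : Fin m, i ≤ j → lam j ≤ lam i) : Antitone (ext lam) := by
  intro s s' h
  by_cases h' : s' < m
  · rw [ext, ext, dif_pos h', dif_pos (h.trans_lt h')]
    exact hlam _ _ h
  · rw [ext, dif_neg h']
    exact Nat.zero_le _

lemma sum_range_ext : ∑ s ∈ Finset.range m, ext lam s = ∑ j, lam j := by
  rw [Finset.sum_range]
  exact Finset.sum_congr rfl fun j _ => by rw [ext, dif_pos j.2]

lemma shapeRow_le (i s : ℕ) : shapeRow T i s ≤ ext lam s :=
  (Finset.card_filter_le _ _).trans_eq (Finset.card_range _)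

lemma shapeRow_eq_ext {i s : ℕ} (h : ∀ c < ext lam s, T.entry s c ≤ i) :
    shapeRow T i s = ext lam s := by
  rw [shapeRow, Finset.filter_true_of_mem, Finset.card_range]
  exact fun c hc => ⟨T.entry_pos s c (Finset.mem_range.1 hc), h c (Finset.mem_range.1 hc)⟩

lemma shapeRow_zero (s : ℕ) : shapeRow T 0 s = 0 := by
  rw [shapeRow, Finset.card_eq_zero, Finset.filter_eq_empty_iff]
  intro c _
  omega

/-- The number of columns to the left of column `c` containing an entry equal to `m`. -/
def numColumns (c : ℕ) : ℕ :=
  ((Finset.range c).filter fun c' => ∃ r' < m, T.entry r' c' = m).card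

lemma numColumns_mono : Monotone (numColumns T) := fun _ _ h =>
  Finset.card_le_card (Finset.filter_subset_filter _ (Finset.range_mono h))

lemma numColumns_le (c : ℕ) : numColumns T c ≤ c :=
  (Finset.card_filter_le _ _).trans_eq (Finset.card_range c)

variable {T} {k R : ℕ}

lemma numColumns_lt_of_shapeRowBox_eq {s c : ℕ} (h : shapeRowBox T m k s = ext lam s)
    (hc : c < ext lam s) (he : T.entry s c = m) : numColumns T c < k := by
  replace h := h.trans (Finset.card_range (ext lam s)).symm
  rw [shapeRowBox, Finset.card_filter_eq_iff] at h
  rcases h c (Finset.mem_range.2 hc) with h | h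
  · omega
  · exact h.2

lemma entry_of_shapeRowBox_add_one_eq (h : shapeRowBox T m k R + 1 = ext lam R) :
    T.entry R (ext lam R - 1) = m ∧ k ≤ numColumns T (ext lam R - 1) := by
  have hne : shapeRowBox T m k R ≠ (Finset.range (ext lam R)).card := by
    rw [Finset.card_range]; omega
  rw [shapeRowBox, Ne, Finset.card_filter_eq_iff] at hne
  push Not at hne
  obtain ⟨c, hc, h1, h2⟩ := hne
  rw [Finset.mem_range] at hc
  have hm : T.entry R c = m :=
    le_antisymm (T.entry_le R c hc) (h1 (T.entry_pos R c hc))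
  have hle : c ≤ ext lam R - 1 := by omega
  refine ⟨le_antisymm (T.entry_le _ _ (by omega)) ?_, (h2 hm).trans (numColumns_mono T hle)⟩
  exact hm.ge.trans (T.row_weak R c _ hle (by omega))

lemma ext_lt_of_shapeRowBox_add_one_eq (h : shapeRowBox T m k R + 1 = ext lam R) {s : ℕ}
    (hs : R < s) : ext lam s < ext lam R := by
  by_contra hlt
  have h1 := T.col_strict R s (ext lam R - 1) hs (by omega)
  have h2 := T.entry_le s (ext lam R - 1) (by omega)
  have h3 := (entry_of_shapeRowBox_add_one_eq h).1
  omega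

lemma shapeRowBox_sub_eq (h : shapeRowBox T m k R + 1 = ext lam R)
    (hother : ∀ s, s ≠ R → shapeRowBox T m k s = ext lam s) (s : ℕ) :
    shapeRowBox T m k s - (ext lam R - 1) = shapeRow T (m - 1) s - (ext lam R - 1) := by
  obtain ⟨h1, h2⟩ := entry_of_shapeRowBox_add_one_eq h
  rcases eq_or_ne s R with rfl | hs
  · have : shapeRow T (m - 1) s ≤ ext lam s - 1 := by
      rw [shapeRow, ← Finset.card_range (ext lam s - 1)]
      refine Finset.card_le_card fun c hc => ?_
      rw [Finset.mem_filter, Finset.mem_range] at hc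
      have : c ≠ ext lam s - 1 := by
        rintro rfl
        omega
      rw [Finset.mem_range]
      omega
    omega
  · rw [hother s hs]
    rcases le_or_gt (ext lam s) (ext lam R - 1) with hle | hlt
    · have := shapeRow_le T (m - 1) s
      omega
    · rw [shapeRow_eq_ext]
      intro c hc
      have h3 := T.row_weak s c (ext lam s - 1) (by omega) (by omega)
      have h4 := T.entry_le s (ext lam s - 1) (by omega)
      have h5 : T.entry s (ext lam s - 1) ≠ m := fun he => by
        have h6 := numColumns_lt_of_shapeRowBox_eq (hother s hs) (by omega) he
        have h7 := numColumns_mono T (show ext lam R - 1 ≤ ext lam s - 1 by omega)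
        omega
      omega

lemma sum_ext_sub (h : shapeRowBox T m k R + 1 = ext lam R) (hR : R < m)
    (hother : ∀ s, s ≠ R → shapeRowBox T m k s = ext lam s) (j : ℕ) :
    ∑ s ∈ Finset.range m, (ext lam s - j) =
      ∑ s ∈ Finset.range m, (shapeRowBox T m k s - j) + if j < ext lam R then 1 else 0 := by
  rw [← Finset.sum_erase_add _ _ (Finset.mem_range.2 hR),
    ← Finset.sum_erase_add _ (fun s => shapeRowBox T m k s - j) (Finset.mem_range.2 hR), add_assoc]
  congr 1
  · exact Finset.sum_congr rfl fun s hs => by rw [hother s (Finset.ne_of_mem_erase hs)]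
  · split_ifs <;> omega

lemma sum_range_ite_lt {M : ℕ} (h : M ≤ m) :
    ∑ s ∈ Finset.range m, (if s < M then 1 else 0) = M := by
  rw [← Finset.card_filter]
  convert Finset.card_range M using 2
  ext s
  simp only [Finset.mem_filter, Finset.mem_range]
  omega

lemma sum_shapeRowBox_sub_pred (hlam : ∀ i j : Fin m, i ≤ j → lam j ≤ lam i)
    (h : shapeRowBox T m k R + 1 = ext lam R) (hR : R < m)
    (hother : ∀ s, s ≠ R → shapeRowBox T m k s = ext lam s) :
    ∑ s ∈ Finset.range m, (shapeRowBox T m k s - (ext lam R - 1)) =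
      ∑ s ∈ Finset.range m, (shapeRowBox T m k s - ext lam R) + R := by
  refine Eq.trans ?_ (congrArg _ (sum_range_ite_lt hR.le))
  rw [← Finset.sum_add_distrib]
  refine Finset.sum_congr rfl fun s _ => ?_
  rcases lt_trichotomy s R with hs | rfl | hs
  · have := ext_antitone hlam hs.le
    rw [hother s hs.ne, if_pos hs]
    omega
  · rw [if_neg (lt_irrefl _)]
    omega
  · have := ext_lt_of_shapeRowBox_add_one_eq h hs
    rw [hother s hs.ne', if_neg hs.not_gt]
    omega

lemma sum_shapeRowBox_sub_pred_add_le (hlam : ∀ i j : Fin m, i ≤ j → lam j ≤ lam i)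
    (h : shapeRowBox T m k R + 1 = ext lam R) (hR : R < m)
    (hother : ∀ s, s ≠ R → shapeRowBox T m k s = ext lam s) {j : ℕ} (hj : j + 2 = ext lam R) :
    ∑ s ∈ Finset.range m, (shapeRowBox T m k s - (j + 1)) + (R + 1) ≤
      ∑ s ∈ Finset.range m, (shapeRowBox T m k s - j) := by
  refine (congrArg _ (sum_range_ite_lt (m := m) (M := R + 1) hR).symm).trans_le ?_
  rw [← Finset.sum_add_distrib]
  refine Finset.sum_le_sum fun s _ => ?_
  rcases lt_trichotomy s R with hs | rfl | hs
  · have := ext_antitone hlam hs.le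
    rw [hother s hs.ne, if_pos (by omega)]
    omega
  · rw [if_pos (by omega)]
    omega
  · rw [if_neg (by omega)]
    omega

end Shapes

/-! ### The fibre -/

lemma finite_setOf_add_smul_mem {V : Type*} [AddCommGroup V] [Module ℂ V]
    {S : Submodule ℂ V} {v : V} (hv : v ∉ S) (w : V) :
    {t : ℂ | v + t • w ∈ S}.Finite := by
  refine Set.Subsingleton.finite fun t ht t' ht' => ?_
  by_contra hne
  have h1 : (t - t') • w ∈ S := by
    have := S.sub_mem ht ht'
    rwa [add_sub_add_left_eq_sub, ← sub_smul] at this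
  have hw : w ∈ S := (S.smul_mem_iff (sub_ne_zero.2 hne)).1 h1
  exact hv ((S.add_mem_iff_left (S.smul_mem t hw)).1 ht)

lemma exists_sub_mem_and_notMem {V : Type*} [AddCommGroup V] [Module ℂ V]
    [FiniteDimensional ℂ V] {L S S' : Submodule ℂ V} {v₀ : V} {P : Prop} (hS : L ⊔ S = ⊤)
    (hlt : P → Module.finrank ℂ S' < Module.finrank ℂ S)
    (htop : P → L ⊔ S' ⊔ Submodule.span ℂ {v₀} = ⊤) :
    ∃ v, v - v₀ ∈ L ∧ v ∈ S ∧ (P → v ∉ S') := by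
  obtain ⟨x, hx, v, hv, hxv⟩ := Submodule.mem_sup.1 (hS.ge (Submodule.mem_top (x := v₀)))
  have hvL : v - v₀ ∈ L := by
    rw [← hxv, sub_add_cancel_right]
    exact L.neg_mem hx
  by_cases h : P ∧ v ∈ S'
  · obtain ⟨hP, hvS'⟩ := h
    have hS' : L ⊔ S' = ⊤ := by
      rw [← htop hP, eq_comm, sup_eq_left, Submodule.span_singleton_le_iff_mem, ← hxv]
      exact Submodule.add_mem_sup hx hvS'
    have hnot : ¬ L ⊓ S ≤ L ⊓ S' := fun hle => by
      have h1 := Submodule.finrank_sup_add_finrank_inf_eq L S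
      have h2 := Submodule.finrank_sup_add_finrank_inf_eq L S'
      have h3 := Submodule.finrank_mono hle
      have h4 := hlt hP
      rw [hS] at h1
      rw [hS'] at h2
      omega
    obtain ⟨u, ⟨huL, huS⟩, hu⟩ := SetLike.not_le_iff_exists.1 hnot
    refine ⟨v + u, ?_, S.add_mem hv huS, fun _ h => hu ⟨huL, ?_⟩⟩
    · rw [add_sub_right_comm]
      exact L.add_mem hvL huL
    · exact (S'.add_mem_iff_right hvS').1 h
  · exact ⟨v, hvL, hv, fun hP hv' => h ⟨hP, hv'⟩⟩

lemma isIrreducibleZ_and_dimZ_bordered {n : ℕ} (B : Matrix (Fin n) (Fin n) ℂ)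
    {L S S' : Submodule ℂ (Fin n → ℂ)} {v₀ : Fin n → ℂ} {P : Prop}
    {F : Set (Matrix (Fin (n + 1)) (Fin (n + 1)) ℂ)} (hne : F.Nonempty)
    (hF : ∀ A, A ∈ F ↔ ∃ v, (v - v₀ ∈ L ∧ v ∈ S ∧ (P → v ∉ S')) ∧ bordered B v = A) :
    isIrreducibleZ F ∧ dimZ F =
      ((Module.finrank ℂ (L ⊓ S : Submodule ℂ (Fin n → ℂ)) : ℕ∞) : WithBot ℕ∞) := by
  rw [(Submodule.equivMapOfInjective _ lastColumn_injective (L ⊓ S)).finrank_eq]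
  have hadd (v w : Fin n → ℂ) (t : ℂ) :
      bordered B v + t • lastColumn n w = bordered B (v + t • w) :=
    (bordered_add_smul B v w t).symm
  refine isIrreducibleZ_and_dimZ hne _ (fun A hA A' hA' => ?_) fun A hA X hX => ?_
  · obtain ⟨v, ⟨hv, hvS, -⟩, rfl⟩ := (hF A).1 hA
    obtain ⟨v', ⟨hv', hvS', -⟩, rfl⟩ := (hF A').1 hA'
    refine ⟨v' - v, ⟨?_, S.sub_mem hvS' hvS⟩, ?_⟩
    · simpa using L.sub_mem hv' hv
    · rw [eq_sub_iff_add_eq', ← one_smul ℂ (lastColumn n _), hadd, one_smul, add_sub_cancel]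
  · obtain ⟨v, ⟨hv, hvS, hvS'⟩, rfl⟩ := (hF A).1 hA
    obtain ⟨w, ⟨hwL, hwS⟩, rfl⟩ := hX
    by_cases hP : P
    · refine (finite_setOf_add_smul_mem (hvS' hP) w).subset fun t ht => ?_
      by_contra hmem
      refine ht ((hF _).2 ⟨v + t • w, ⟨?_, S.add_mem hvS (S.smul_mem t hwS), fun _ => hmem⟩,
        (hadd v w t).symm⟩)
      rw [add_sub_right_comm]
      exact L.add_mem hv (L.smul_mem t hwL)
    · convert Set.finite_empty
      refine Set.eq_empty_of_forall_notMem fun t ht => ht ((hF _).2 ⟨v + t • w,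
        ⟨?_, S.add_mem hvS (S.smul_mem t hwS), fun h => absurd h hP⟩, (hadd v w t).symm⟩)
      rw [add_sub_right_comm]
      exact L.add_mem hv (L.smul_mem t hwL)

section Corners

variable {n : ℕ}

lemma corner_self (B : Matrix (Fin n) (Fin n) ℂ) : corner B n = B := by
  ext i j
  rw [corner_apply le_rfl]
  rfl

lemma corner_bordered {d : ℕ} (h : d ≤ n) (B : Matrix (Fin n) (Fin n) ℂ) (v : Fin n → ℂ) :
    corner (bordered B v) d = corner B d := by
  ext i j
  rw [corner_apply (h.trans n.le_succ), corner_apply h]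
  exact bordered_castSucc_castSucc B v (Fin.castLE h i) (Fin.castLE h j)

lemma upperTri_bordered {B : Matrix (Fin n) (Fin n) ℂ} (hB : upperTri B) (v : Fin n → ℂ) :
    upperTri (bordered B v) := by
  intro i j
  refine Fin.lastCases (fun _ => bordered_last B v j) (fun i => ?_) i
  refine Fin.lastCases (fun h => ?_) (fun j h => ?_) j
  · simp only [Fin.val_last, Fin.val_castSucc] at h
    omega
  · rw [bordered_castSucc_castSucc]
    exact hB i j h

lemma hasType.exists_rank_pow_eq_zero {A : Matrix (Fin n) (Fin n) ℂ} {rows : ℕ} {κ : ℕ → ℕ}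
    (h : hasType A rows κ) : ∃ k, (A ^ k).rank = 0 := by
  refine ⟨∑ s ∈ Finset.range rows, κ s + 1, ?_⟩
  rw [h _ (Nat.le_add_left 1 _)]
  refine Finset.sum_eq_zero fun s hs => ?_
  have := Finset.single_le_sum (f := κ) (fun _ _ => Nat.zero_le _) hs
  omega

lemma eq_bordered_corner {A : Matrix (Fin (n + 1)) (Fin (n + 1)) ℂ} (hA : upperTri A)
    {rows : ℕ} {κ : ℕ → ℕ} (h : hasType A rows κ) :
    A = bordered (corner A n) fun i => A i.castSucc (Fin.last n) := by
  obtain ⟨k, hk⟩ := h.exists_rank_pow_eq_zero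
  ext i j
  refine Fin.lastCases ?_ (fun i => ?_) i
  · rw [bordered_last, upperTri_last_row hA hk]
  · refine Fin.lastCases ?_ (fun j => ?_) j
    · rw [bordered_castSucc_last]
    · rw [bordered_castSucc_castSucc, corner_apply n.le_succ]
      rfl

lemma row_eq_zero_of_hasType {B : Matrix (Fin n) (Fin n) ℂ} (hB : upperTri B)
    {rows : ℕ} {κ : ℕ → ℕ} (h : hasType B rows κ) (i : Fin n) (hi : (i : ℕ) + 1 = n)
    (j : Fin n) : B i j = 0 := by
  obtain ⟨k, hk⟩ := h.exists_rank_pow_eq_zero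
  cases n with
  | zero => exact i.elim0
  | succ n =>
    rw [show i = Fin.last n from Fin.ext (by rw [Fin.val_last]; omega)]
    exact upperTri_last_row hB hk j

end Corners

section Fibre

variable {m n : ℕ} {lam μ : Fin m → ℕ} {T : Tableau m lam μ} {k R : ℕ}
  {B : Matrix (Fin n) (Fin n) ℂ}

lemma rank_pow_of_hasType_shapeRowBox (h : shapeRowBox T m k R + 1 = ext lam R) (hR : R < m)
    (hother : ∀ s, s ≠ R → shapeRowBox T m k s = ext lam s) (hn : ∑ j, lam j = n + 1)
    (hB : hasType B m (shapeRowBox T m k)) (j : ℕ) :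
    (B ^ j).rank = ∑ s ∈ Finset.range m, (shapeRowBox T m k s - j) := by
  rcases Nat.eq_zero_or_pos j with rfl | hj
  · have := sum_ext_sub h hR hother 0
    rw [if_pos (by omega)] at this
    simp only [Nat.sub_zero, sum_range_ext, hn] at this ⊢
    rw [pow_zero, Matrix.rank_one, Fintype.card_fin]
    omega
  · exact hB j hj

lemma hasType_bordered_iff (h : shapeRowBox T m k R + 1 = ext lam R) (hR : R < m)
    (hother : ∀ s, s ≠ R → shapeRowBox T m k s = ext lam s)
    (hB : hasType B m (shapeRowBox T m k)) (v : Fin n → ℂ) :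
    hasType (bordered B v) m (ext lam) ↔
      v ∈ Ssub B (ext lam R) ∧ (2 ≤ ext lam R → v ∉ Ssub B (ext lam R - 1)) := by
  have key : hasType (bordered B v) m (ext lam) ↔ ∀ j, v ∈ Ssub B (j + 1) ↔ ext lam R ≤ j + 1 := by
    refine ⟨fun hA j => ?_, fun hA j hj => ?_⟩
    · have := hA (j + 1) (Nat.le_add_left 1 j)
      rw [rank_bordered_pow, hB _ (Nat.le_add_left 1 j), sum_ext_sub h hR hother] at this
      by_cases hv : v ∈ Ssub B (j + 1) <;> by_cases hj : j + 1 < ext lam R <;>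
        simp only [hv, hj, if_true, if_false, true_iff, false_iff] at this ⊢ <;> omega
    · obtain ⟨j, rfl⟩ := Nat.exists_eq_add_of_le' hj
      rw [rank_bordered_pow, hB _ hj, sum_ext_sub h hR hother]
      simp only [hA, ← not_lt, ite_not]
  obtain ⟨l, hl⟩ : ∃ l, ext lam R = l + 1 := ⟨_, h.symm⟩
  rw [key, hl]
  refine ⟨fun hA => ⟨(hA l).2 le_rfl, fun h2 => ?_⟩, fun ⟨h1, h2⟩ j => ⟨fun hv => ?_, fun hj => ?_⟩⟩
  · obtain ⟨l, rfl⟩ : ∃ l', l = l' + 1 := ⟨l - 1, by omega⟩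
    rw [Nat.add_sub_cancel, hA]
    omega
  · by_contra hlt
    obtain ⟨l, rfl⟩ : ∃ l', l = l' + 1 := ⟨l - 1, by omega⟩
    exact h2 (by omega) (Ssub_succ_mono B (show j ≤ l by omega) hv)
  · exact Ssub_succ_mono B (show l ≤ j by omega) h1

end Fibre

section Main

variable {m n : ℕ} {lam μ : Fin m → ℕ} {T : Tableau m lam μ} {ℓ : Fin m} {R : ℕ}
  {B : Matrix (Fin n) (Fin n) ℂ}

lemma hasType_of_mem_XcircMinus (hℓ : (ℓ : ℕ) + 1 = m) (hμpos : ∀ i, 1 ≤ μ i)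
    (hn : n + 1 = ∑ j, μ j) (hB : B ∈ XcircMinus μ lam (n + 1) T ℓ) :
    hasType B m (shapeRowBox T m (μ ℓ - 1)) := by
  have h := hB.2.2 ℓ
  have hsum := off_last μ hℓ
  have hpos := hμpos ℓ
  rw [if_pos hℓ, off_update hℓ, Function.update_self,
    show off μ ℓ + (μ ℓ - 1) = n by omega] at h
  exact corner_self B ▸ h

lemma hasType_corner_of_mem_XcircMinus (hℓ : (ℓ : ℕ) + 1 = m)
    (hB : B ∈ XcircMinus μ lam (n + 1) T ℓ) {i : Fin m} (hi : i ≠ ℓ) :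
    hasType (corner B (off μ i + μ i)) m (shapeRow T (i + 1)) := by
  have h := hB.2.2 i
  rw [if_neg (fun h => hi (Fin.ext (by omega))), off_update hℓ, Function.update_of_ne hi] at h
  exact h

lemma rank_corner_off_pow (hℓ : (ℓ : ℕ) + 1 = m)
    (hB : B ∈ XcircMinus μ lam (n + 1) T ℓ) {k : ℕ} (hk : 1 ≤ k) :
    (corner B (off μ ℓ) ^ k).rank = ∑ s ∈ Finset.range m, (shapeRow T (m - 1) s - k) := by
  obtain ⟨l, hl⟩ := ℓ
  cases l with
  | zero =>
    have h0 : m - 1 = 0 := by simp only at hℓ; omega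
    rw [off_zero, h0]
    simpa [shapeRow_zero] using Matrix.rank_le_width (corner B 0 ^ k)
  | succ l =>
    have h := hasType_corner_of_mem_XcircMinus hℓ hB (i := ⟨l, by omega⟩) (by simp) k hk
    rw [off_succ, h]
    simp only at hℓ ⊢
    rw [show m - 1 = l + 1 by omega]

lemma mem_fibre_iff (hℓ : (ℓ : ℕ) + 1 = m)
    (hμmono : ∀ i j : Fin m, i ≤ j → μ j ≤ μ i) (hμpos : ∀ i, 1 ≤ μ i)
    (hn : n + 1 = ∑ j, μ j) (hR : R < m)
    (hrow : shapeRowBox T m (μ ℓ - 1) R + 1 = ext lam R)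
    (hother : ∀ s, s ≠ R → shapeRowBox T m (μ ℓ - 1) s = ext lam s)
    (hB : B ∈ XcircMinus μ lam (n + 1) T ℓ) (A : Matrix (Fin (n + 1)) (Fin (n + 1)) ℂ) :
    A ∈ Xcirc μ lam (n + 1) T ∧ corner A n = B ↔
      ∃ v, (v - baseVec μ ℓ n ∈ Lspan μ n ∧ v ∈ Ssub B (ext lam R) ∧
        (2 ≤ ext lam R → v ∉ Ssub B (ext lam R - 1))) ∧ bordered B v = A := by
  have hsum := off_last μ hℓ
  have htype := hasType_of_mem_XcircMinus hℓ hμpos hn hB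
  have hshape : shapeRow T (ℓ + 1) = ext lam := funext fun s =>
    shapeRow_eq_ext T fun c hc => (T.entry_le s c hc).trans_eq hℓ.symm
  have hslice (v : Fin n → ℂ) := inSlice_bordered_iff hℓ hμmono hμpos hn hB.1
    (row_eq_zero_of_hasType hB.2.1 htype) v
  have hfull (A : Matrix (Fin (n + 1)) (Fin (n + 1)) ℂ) :
      hasType (corner A (off μ ℓ + μ ℓ)) m (shapeRow T (ℓ + 1)) ↔ hasType A m (ext lam) := by
    rw [hsum, ← hn, corner_self, hshape]
  constructor
  · rintro ⟨⟨h1, h2, h3⟩, rfl⟩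
    have hA := (hfull A).1 (h3 ℓ)
    have heq := eq_bordered_corner h2 hA
    refine ⟨fun i => A i.castSucc (Fin.last n), ⟨(hslice _).1 (by rwa [← heq]), ?_⟩, heq.symm⟩
    exact (hasType_bordered_iff hrow hR hother htype _).1 (by rwa [← heq])
  · rintro ⟨v, ⟨h1, h2⟩, rfl⟩
    refine ⟨⟨(hslice v).2 h1, upperTri_bordered hB.2.1 v, fun i => ?_⟩, ?_⟩
    · rcases eq_or_ne i ℓ with rfl | hi
      · exact (hfull _).2 ((hasType_bordered_iff hrow hR hother htype v).2 h2)
      · have hle := off_add_le μ (lt_of_le_of_ne (Fin.le_def.2 (by omega)) hi)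
        have := hμpos ℓ
        rw [corner_bordered (by omega)]
        exact hasType_corner_of_mem_XcircMinus hℓ hB hi
    · rw [corner_bordered le_rfl, corner_self]

lemma Lspan_sup_range_sup_baseVec (hℓ : (ℓ : ℕ) + 1 = m) (hμpos : ∀ i, 1 ≤ μ i)
    (hn : n + 1 = ∑ j, μ j) (hB : B ∈ XcircMinus μ lam (n + 1) T ℓ) :
    Lspan μ n ⊔ LinearMap.range B.mulVecLin ⊔ Submodule.span ℂ {baseVec μ ℓ n} = ⊤ := by
  have hlast := row_eq_zero_of_hasType hB.2.1 (hasType_of_mem_XcircMinus hℓ hμpos hn hB)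
  rw [eq_top_iff, ← (Pi.basisFun ℂ (Fin n)).span_eq, Submodule.span_le]
  rintro _ ⟨i, rfl⟩
  rw [Pi.basisFun_apply]
  by_cases hi : (i : ℕ) + 1 < n ∨ μ ℓ = 1
  · exact Submodule.mem_sup_left (single_mem_Lspan_sup_range hℓ hμpos hn hB.1 hlast i hi)
  · refine Submodule.mem_sup_right (Submodule.mem_span_singleton.2 ⟨1, ?_⟩)
    have := hμpos ℓ
    funext j
    rw [one_smul, Pi.single_apply, baseVec]
    refine if_congr ⟨fun h => Fin.ext (by omega), ?_⟩ rfl rfl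
    rintro rfl
    omega

lemma baseVec_mem (hℓ : (ℓ : ℕ) + 1 = m) (hμpos : ∀ i, 1 ≤ μ i)
    (hn : n + 1 = ∑ j, μ j)
    (hrow : shapeRowBox T m (μ ℓ - 1) R + 1 = ext lam R)
    (hother : ∀ s, s ≠ R → shapeRowBox T m (μ ℓ - 1) s = ext lam s)
    (hB : B ∈ XcircMinus μ lam (n + 1) T ℓ) :
    baseVec μ ℓ n ∈ Lspan μ n ⊔ Ssub B (ext lam R) := by
  obtain ⟨l, hl⟩ : ∃ l, ext lam R = l + 1 := ⟨_, hrow.symm⟩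
  have hle : Lspan μ n ⊔ LinearMap.range B.mulVecLin ≤ Lspan μ n ⊔ Ssub B (l + 1) :=
    sup_le_sup_left (range_le_Ssub_succ B l) _
  rw [hl]
  by_cases hμ : 2 ≤ μ ℓ
  · have htype := hasType_of_mem_XcircMinus hℓ hμpos hn hB
    have hlast := row_eq_zero_of_hasType hB.2.1 htype
    have hsum := off_last μ hℓ
    have hd : off μ ℓ ≤ n := by omega
    have hl1 : 1 ≤ l := by
      have := (entry_of_shapeRowBox_add_one_eq hrow).2.trans (numColumns_le T _)
      omega
    obtain ⟨x, hx⟩ := exists_mulVec_pow_eq_of_rank_corner hd hB.2.1 l (by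
      rw [htype l hl1, rank_corner_off_pow hℓ hB hl1]
      refine Finset.sum_congr rfl fun s _ => ?_
      simpa only [hl, Nat.add_sub_cancel] using shapeRowBox_sub_eq hrow hother s)
      (baseVec μ ℓ n)
    rw [← sub_add_cancel (baseVec μ ℓ n) (extendZero (Fin.castLE hd) x)]
    refine Submodule.add_mem _ (Submodule.mem_sup_right (ker_le_Ssub_succ B l ?_)) (hle ?_)
    · rw [LinearMap.mem_ker, map_sub, Matrix.mulVecLin_apply, Matrix.mulVecLin_apply, hx, sub_self]
    · rw [pi_eq_sum_univ' (extendZero (Fin.castLE hd) x)]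
      refine Submodule.sum_mem _ fun i _ => ?_
      by_cases hi : i ∈ Set.range (Fin.castLE hd)
      · refine Submodule.smul_mem _ _ ?_
        obtain ⟨i, rfl⟩ := hi
        convert single_mem_Lspan_sup_range hℓ hμpos hn hB.1 hlast (Fin.castLE hd i)
          (Or.inl (by rw [Fin.val_castLE]; omega)) using 1
      · rw [extendZero_of_notMem _ hi, zero_smul]
        exact Submodule.zero_mem _
  · rw [show baseVec μ ℓ n = 0 from funext fun i => if_neg fun h => hμ h.2]
    exact Submodule.zero_mem _

lemma fibre_nonempty_irreducible_dim (hℓ : (ℓ : ℕ) + 1 = m)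
    (hμmono : ∀ i j : Fin m, i ≤ j → μ j ≤ μ i) (hμpos : ∀ i, 1 ≤ μ i)
    (hn : n + 1 = ∑ j, μ j) (hlammono : ∀ i j : Fin m, i ≤ j → lam j ≤ lam i)
    (hlamsum : ∑ j, lam j = n + 1) (hR : R < m)
    (hrow : shapeRowBox T m (μ ℓ - 1) R + 1 = ext lam R)
    (hother : ∀ s, s ≠ R → shapeRowBox T m (μ ℓ - 1) s = ext lam s)
    (hB : B ∈ XcircMinus μ lam (n + 1) T ℓ) :
    {A | A ∈ Xcirc μ lam (n + 1) T ∧ corner A n = B}.Nonempty ∧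
    isIrreducibleZ {A | A ∈ Xcirc μ lam (n + 1) T ∧ corner A n = B} ∧
    dimZ {A | A ∈ Xcirc μ lam (n + 1) T ∧ corner A n = B} =
      (((m - (R + 1) : ℕ) : ℕ∞) : WithBot ℕ∞) := by
  have hF := mem_fibre_iff hℓ hμmono hμpos hn hR hrow hother hB
  have hrank := rank_pow_of_hasType_shapeRowBox hrow hR hother hlamsum
    (hasType_of_mem_XcircMinus hℓ hμpos hn hB)
  have hv₀ := baseVec_mem hℓ hμpos hn hrow hother hB
  have htop (l : ℕ) :
      Lspan μ n ⊔ Ssub B (l + 1) ⊔ Submodule.span ℂ {baseVec μ ℓ n} = ⊤ := by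
    rw [eq_top_iff, ← Lspan_sup_range_sup_baseVec hℓ hμpos hn hB]
    exact sup_le_sup_right (sup_le_sup_left (range_le_Ssub_succ B l) _) _
  have hpred := sum_shapeRowBox_sub_pred hlammono hrow hR hother
  have hpred' := fun j => sum_shapeRowBox_sub_pred_add_le hlammono hrow hR hother (j := j)
  obtain ⟨l, hl⟩ : ∃ l, ext lam R = l + 1 := ⟨_, hrow.symm⟩
  simp only [hl, Nat.add_sub_cancel, ← hrank] at hF hv₀ hpred hpred'
  have hS : Lspan μ n ⊔ Ssub B (l + 1) = ⊤ := by
    rw [← htop l, eq_comm, sup_eq_left, Submodule.span_singleton_le_iff_mem]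
    exact hv₀
  have hdim := finrank_Ssub_succ B l
  have hne : {A | A ∈ Xcirc μ lam (n + 1) T ∧ corner A n = B}.Nonempty := by
    obtain ⟨v, hv⟩ := exists_sub_mem_and_notMem (L := Lspan μ n) (S := Ssub B (l + 1))
      (S' := Ssub B l) (v₀ := baseVec μ ℓ n) (P := 2 ≤ l + 1) hS
      (fun h2 => by
        obtain ⟨j, rfl⟩ : ∃ j, l = j + 1 := ⟨l - 1, by omega⟩
        have h3 := finrank_Ssub_succ B j
        have h4 := hpred' j rfl
        omega)
      (fun h2 => by
        obtain ⟨j, rfl⟩ : ∃ j, l = j + 1 := ⟨l - 1, by omega⟩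
        exact htop j)
    exact ⟨_, (hF _).2 ⟨v, hv, rfl⟩⟩
  obtain ⟨hirr, hdimF⟩ := isIrreducibleZ_and_dimZ_bordered B hne hF
  refine ⟨hne, hirr, hdimF.trans ?_⟩
  have hinf := Submodule.finrank_sup_add_finrank_inf_eq (Lspan μ n) (Ssub B (l + 1))
  rw [hS, finrank_top, Module.finrank_fin_fun, finrank_Lspan hℓ hμpos hn] at hinf
  congr 2
  omega

end Main

/-- For every `B ∈ X̊_{τ−[m]}`, the fibre of the restriction map
`X̊_τ → X̊_{τ−[m]}`, `A ↦ A_{(m, μ_m−1)}`, over `B` is a nonempty irreducible subset of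
dimension `m − r` in the Zariski topology. -/
theorem stmt8 (m : ℕ) (hm : 1 ≤ m) (μ : Fin m → ℕ)
    (hμmono : ∀ i j : Fin m, i ≤ j → μ j ≤ μ i) (hμpos : ∀ i : Fin m, 1 ≤ μ i)
    (N : ℕ) (hN : N = ∑ j, μ j)
    (lam : Fin m → ℕ) (hlammono : ∀ i j : Fin m, i ≤ j → lam j ≤ lam i)
    (hlamsum : ∑ j, lam j = N)
    (T : Tableau m lam μ)
    (r : ℕ) (hr1 : 1 ≤ r) (hrm : r ≤ m)
    (hrow : shapeRowBox T m (μ ⟨m - 1, by omega⟩ - 1) (r - 1) + 1 = ext lam (r - 1))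
    (hother : ∀ s : ℕ, s ≠ r - 1 →
      shapeRowBox T m (μ ⟨m - 1, by omega⟩ - 1) s = ext lam s)
    (B : Matrix (Fin (N - 1)) (Fin (N - 1)) ℂ)
    (hB : B ∈ XcircMinus μ lam N T ⟨m - 1, by omega⟩) :
    {A : Matrix (Fin N) (Fin N) ℂ | A ∈ Xcirc μ lam N T ∧ corner A (N - 1) = B}.Nonempty ∧
    isIrreducibleZ {A : Matrix (Fin N) (Fin N) ℂ | A ∈ Xcirc μ lam N T ∧ corner A (N - 1) = B} ∧
    dimZ {A : Matrix (Fin N) (Fin N) ℂ | A ∈ Xcirc μ lam N T ∧ corner A (N - 1) = B}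
      = (((m - r : ℕ) : ℕ∞) : WithBot ℕ∞) := by
  obtain ⟨n, rfl⟩ : ∃ n, N = n + 1 := by
    have := Finset.single_le_sum (f := μ) (fun _ _ => Nat.zero_le _)
      (Finset.mem_univ ⟨m - 1, by omega⟩)
    have := hμpos ⟨m - 1, by omega⟩
    exact ⟨N - 1, by omega⟩
  have h := fibre_nonempty_irreducible_dim (ℓ := ⟨m - 1, by omega⟩) (R := r - 1)
    (by simp only; omega) hμmono hμpos hN hlammono hlamsum (by omega) hrow hother hB
  rwa [show r - 1 + 1 = r by omega] at h

end Gov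
end
end

section
/- Let X ⊆ ℂ^a and Y ⊆ ℂ^b be nonempty locally closed subsets in the Zariski topology and let f : X → Y be a surjective map which is the restriction of a polynomial map ℂ^a → ℂ^b. Assume there is an integer d ≥ 0 such that for every y ∈ Y the fibre f^{-1}(y) is an irreducible subset of X of dimension d. Assume further that Y has exactly one irreducible component of dimension M and that every other irreducible component of Y has dimension strictly less than M. Then X has exactly one irreducible component of dimension M + d, and every other irreducible component of X has dimension strictly less than M + d. -/
noncomputable section

namespace GovNine

/-- The Zariski topology on `ℂ^n`: closed sets are common zero sets of families of
polynomials. -/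
def pzar (n : ℕ) : TopologicalSpace (Fin n → ℂ) :=
  TopologicalSpace.generateFrom
    { U | ∃ p : MvPolynomial (Fin n) ℂ, U = { x | MvPolynomial.eval x p ≠ 0 } }

/-- Irreducibility for the Zariski topology. -/
def isIrreducibleP {n : ℕ} (S : Set (Fin n → ℂ)) : Prop :=
  letI := pzar n
  IsIrreducible S

/-- Local closedness for the Zariski topology. -/
def isLocallyClosedP {n : ℕ} (S : Set (Fin n → ℂ)) : Prop :=
  letI := pzar n
  IsLocallyClosed S

/-- Irreducible components of a subset: its maximal irreducible subsets. -/
def irrCompsP {n : ℕ} (S : Set (Fin n → ℂ)) : Set (Set (Fin n → ℂ)) :=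
  { C | C ⊆ S ∧ isIrreducibleP C ∧
      ∀ C', C' ⊆ S → isIrreducibleP C' → C ⊆ C' → C' = C }

/-- Dimension of a subset: its Krull dimension as a topological space
(with the subspace Zariski topology). -/
def dimP {n : ℕ} (S : Set (Fin n → ℂ)) : WithBot ℕ∞ :=
  letI := pzar n
  topologicalKrullDim S

section Zariski

open MvPolynomial

theorem ringKrullDim_eq_of_isIntegral_of_injective {A B : Type*} [CommRing A] [CommRing B]
    [Algebra A B] [Algebra.IsIntegral A B]
    (h : Function.Injective (algebraMap A B)) : ringKrullDim A = ringKrullDim B := by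
  apply le_antisymm
  · refine iSup_le fun p => ?_
    obtain ⟨Q, -, hQ, hQp⟩ := Ideal.exists_ideal_over_prime_of_isIntegral (S := B)
      p.head.asIdeal ⊥ (by
        rw [← RingHom.ker_eq_comap_bot, (RingHom.injective_iff_ker_eq_bot _).1 h]
        exact bot_le)
    have : Q.LiesOver p.head.asIdeal := ⟨hQp.symm⟩
    obtain ⟨L, hL, -⟩ := Ideal.exists_ltSeries_of_hasGoingUp (S := B) p Q
    rw [← hL]
    exact le_iSup (fun L : LTSeries (PrimeSpectrum B) => ((L.length : ℕ) : WithBot ℕ∞)) L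
  · refine Order.krullDim_le_of_strictMono (PrimeSpectrum.comap (algebraMap A B)) ?_
    intro p q hpq
    exact Ideal.IsIntegral.comap_lt_comap (R := A) hpq

theorem ringKrullDim_eq_trdeg (k B : Type*) [Field k] [CommRing B] [IsDomain B] [Algebra k B]
    [Algebra.FiniteType k B] :
    ringKrullDim B = ((Cardinal.toNat (Algebra.trdeg k B) : ℕ∞) : WithBot ℕ∞) := by
  obtain ⟨s, g, hg, hBint⟩ := exists_integral_inj_algHom_of_fg k B
  let := g.toRingHom.toAlgebra
  have : IsScalarTower k (MvPolynomial (Fin s) k) B := IsScalarTower.of_algebraMap_eq' (by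
    ext x; exact (g.commutes x).symm)
  have hi : Function.Injective (algebraMap (MvPolynomial (Fin s) k) B) := hg
  have : Algebra.IsIntegral (MvPolynomial (Fin s) k) B := ⟨hBint⟩
  have : FaithfulSMul (MvPolynomial (Fin s) k) B := (faithfulSMul_iff_algebraMap_injective _ _).2 hi
  rw [← ringKrullDim_eq_of_isIntegral_of_injective hi,
    MvPolynomial.ringKrullDim_of_isNoetherianRing]
  have h2 := lift_trdeg_add_eq k (MvPolynomial (Fin s) k) B
  have h3 : Algebra.trdeg (MvPolynomial (Fin s) k) B = 0 := trdeg_eq_zero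
  rw [h3] at h2
  have h4 := congrArg Cardinal.toNat h2
  simp at h4
  rw [← h4]
  simp [ringKrullDim_eq_zero_of_field]

/-- The dimension of the coordinate ring of a prime ideal, as a transcendence degree. -/
def quotientTrdeg {n : ℕ} (P : Ideal (MvPolynomial (Fin n) ℂ)) : ℕ :=
  Cardinal.toNat (Algebra.trdeg ℂ (MvPolynomial (Fin n) ℂ ⧸ P))

theorem trdeg_quotient_eq {n : ℕ} (P : Ideal (MvPolynomial (Fin n) ℂ)) :
    Algebra.trdeg ℂ (MvPolynomial (Fin n) ℂ ⧸ P) = quotientTrdeg P :=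
  (Cardinal.cast_toNat_of_lt_aleph0 trdeg_lt_aleph0_of_finiteType).symm

theorem algebraicIndependent_quotient_mk_iff {n e : ℕ} {J : Ideal (MvPolynomial (Fin n) ℂ)}
    {t : Fin e → MvPolynomial (Fin n) ℂ} :
    AlgebraicIndependent ℂ (fun i => Ideal.Quotient.mk J (t i)) ↔
      ∀ q : MvPolynomial (Fin e) ℂ, aeval t q ∈ J → q = 0 := by
  rw [algebraicIndependent_iff]
  refine forall_congr' fun q => ?_
  have : aeval (fun i => Ideal.Quotient.mk J (t i)) q = Ideal.Quotient.mk J (aeval t q) := by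
    rw [← Ideal.Quotient.mkₐ_eq_mk ℂ, ← AlgHom.comp_apply]
    congr 1
    ext i
    simp
  rw [this, Ideal.Quotient.eq_zero_iff_mem]

theorem le_quotientTrdeg {n e : ℕ} {P : Ideal (MvPolynomial (Fin n) ℂ)}
    {t : Fin e → MvPolynomial (Fin n) ℂ}
    (ht : ∀ q : MvPolynomial (Fin e) ℂ, aeval t q ∈ P → q = 0) : e ≤ quotientTrdeg P := by
  have h := (algebraicIndependent_quotient_mk_iff.2 ht).cardinalMk_le_trdeg
  rw [trdeg_quotient_eq] at h
  simpa using h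

theorem eq_of_quotientTrdeg_le {n e : ℕ} {P J : Ideal (MvPolynomial (Fin n) ℂ)} [P.IsPrime]
    (hPJ : P ≤ J) {t : Fin e → MvPolynomial (Fin n) ℂ}
    (ht : ∀ q : MvPolynomial (Fin e) ℂ, aeval t q ∈ J → q = 0) (he : quotientTrdeg P ≤ e) :
    J = P := by
  have hi := algebraicIndependent_quotient_mk_iff.2 fun q hq => ht q (hPJ hq)
  have hb := hi.isTranscendenceBasis_of_trdeg_le_of_finite (by
    rw [trdeg_quotient_eq]; simpa using he)
  by_contra hne
  obtain ⟨x, hxJ, hxP⟩ := SetLike.exists_of_lt (lt_of_le_of_ne hPJ (Ne.symm hne))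
  have halg := hb.isAlgebraic
  have hx : IsAlgebraic (Algebra.adjoin ℂ (Set.range fun i => Ideal.Quotient.mk P (t i)))
    (Ideal.Quotient.mk P x) := halg.isAlgebraic _
  have h1 := Ideal.comap_ne_bot_of_algebraic_mem (I := J.map (Ideal.Quotient.mk P))
    (by rwa [Ne, Ideal.Quotient.eq_zero_iff_mem]) (Ideal.mem_map_of_mem _ hxJ) hx
  obtain ⟨⟨y, hy⟩, hyJ, hy0⟩ := Submodule.exists_mem_ne_zero_of_ne_bot h1
  rw [Algebra.adjoin_range_eq_range_aeval] at hy
  obtain ⟨q, rfl⟩ := hy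
  have hq : aeval (fun i => Ideal.Quotient.mk P (t i)) q = Ideal.Quotient.mk P (aeval t q) := by
    rw [← Ideal.Quotient.mkₐ_eq_mk ℂ, ← AlgHom.comp_apply]
    congr 1
    ext i
    simp
  have h2 : Ideal.Quotient.mk P (aeval t q) ∈ J.map (Ideal.Quotient.mk P) := by
    rw [← hq]; exact hyJ
  rw [Ideal.mem_quotient_iff_mem hPJ] at h2
  have := ht q h2
  subst this
  exact hy0 (Subtype.ext (map_zero _))

theorem exists_quotientTrdeg_basis {n : ℕ} (P : Ideal (MvPolynomial (Fin n) ℂ)) [P.IsPrime] :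
    ∃ t : Fin (quotientTrdeg P) → MvPolynomial (Fin n) ℂ,
      ∀ q : MvPolynomial (Fin (quotientTrdeg P)) ℂ, aeval t q ∈ P → q = 0 := by
  obtain ⟨s, hs⟩ := exists_isTranscendenceBasis ℂ (MvPolynomial (Fin n) ℂ ⧸ P)
  have hc := hs.cardinalMk_eq_trdeg
  rw [trdeg_quotient_eq, ← Cardinal.mk_fin] at hc
  have hc' : Nonempty (Fin (quotientTrdeg P) ≃ s) := by
    rw [← Cardinal.eq, ]
    simpa using hc.symm
  obtain ⟨g⟩ := hc'
  choose t ht using fun i => Ideal.Quotient.mk_surjective (I := P) (g i : _)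
  refine ⟨t, algebraicIndependent_quotient_mk_iff.1 ?_⟩
  simp_rw [ht]
  exact hs.1.comp g g.injective

theorem quotientTrdeg_anti {n : ℕ} {P Q : Ideal (MvPolynomial (Fin n) ℂ)} [Q.IsPrime]
    (h : P ≤ Q) : quotientTrdeg Q ≤ quotientTrdeg P := by
  obtain ⟨t, ht⟩ := exists_quotientTrdeg_basis Q
  exact le_quotientTrdeg fun q hq => ht q (h hq)

theorem eq_of_le_of_quotientTrdeg_le {n : ℕ} {P Q : Ideal (MvPolynomial (Fin n) ℂ)} [P.IsPrime]
    [Q.IsPrime] (h : P ≤ Q) (h' : quotientTrdeg P ≤ quotientTrdeg Q) : Q = P := by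
  obtain ⟨t, ht⟩ := exists_quotientTrdeg_basis Q
  exact eq_of_quotientTrdeg_le h ht h'

theorem ringKrullDim_quotient_eq {n : ℕ} (P : Ideal (MvPolynomial (Fin n) ℂ)) [P.IsPrime] :
    ringKrullDim (MvPolynomial (Fin n) ℂ ⧸ P) = ((quotientTrdeg P : ℕ∞) : WithBot ℕ∞) :=
  ringKrullDim_eq_trdeg ℂ _

theorem ringKrullDim_localizationAway_eq {n : ℕ} (P : Ideal (MvPolynomial (Fin n) ℂ)) [P.IsPrime]
    {h : MvPolynomial (Fin n) ℂ} (hh : h ∉ P) :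
    ringKrullDim (Localization.Away (Ideal.Quotient.mk P h)) =
      ((quotientTrdeg P : ℕ∞) : WithBot ℕ∞) := by
  have h0 : Ideal.Quotient.mk P h ≠ 0 := by rwa [Ne, Ideal.Quotient.eq_zero_iff_mem]
  have hle := powers_le_nonZeroDivisors_of_noZeroDivisors h0
  have : IsDomain (Localization.Away (Ideal.Quotient.mk P h)) :=
    IsLocalization.isDomain_localization hle
  have : Algebra.FiniteType (MvPolynomial (Fin n) ℂ ⧸ P)
    (Localization.Away (Ideal.Quotient.mk P h)) :=
    IsLocalization.finiteType_of_monoid_fg (Submonoid.powers (Ideal.Quotient.mk P h)) _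
  have : Algebra.FiniteType ℂ (Localization.Away (Ideal.Quotient.mk P h)) :=
    Algebra.FiniteType.trans (S := MvPolynomial (Fin n) ℂ ⧸ P) inferInstance inferInstance
  rw [ringKrullDim_eq_trdeg ℂ, quotientTrdeg]
  have hi := IsLocalization.injective (Localization.Away (Ideal.Quotient.mk P h)) hle
  have : FaithfulSMul (MvPolynomial (Fin n) ℂ ⧸ P)
    (Localization.Away (Ideal.Quotient.mk P h)) := (faithfulSMul_iff_algebraMap_injective _ _).2 hi
  have : Algebra.IsAlgebraic (MvPolynomial (Fin n) ℂ ⧸ P)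
    (Localization.Away (Ideal.Quotient.mk P h)) :=
    IsLocalization.isAlgebraic _ (Submonoid.powers (Ideal.Quotient.mk P h))
  have h3 : Algebra.trdeg (MvPolynomial (Fin n) ℂ ⧸ P)
    (Localization.Away (Ideal.Quotient.mk P h)) = 0 := trdeg_eq_zero
  rw [← trdeg_add_eq ℂ (MvPolynomial (Fin n) ℂ ⧸ P)
    (A := Localization.Away (Ideal.Quotient.mk P h)), h3, add_zero]

/-- The ideal of polynomials vanishing on a set. -/
abbrev idealOf {n : ℕ} (S : Set (Fin n → ℂ)) : Ideal (MvPolynomial (Fin n) ℂ) :=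
  vanishingIdeal ℂ S

theorem mem_idealOf {n : ℕ} {S : Set (Fin n → ℂ)} {p : MvPolynomial (Fin n) ℂ} :
    p ∈ idealOf S ↔ ∀ x ∈ S, eval x p = 0 := by
  simp [idealOf, MvPolynomial.aeval_eq_eval]

attribute [local instance] pzar

theorem pzar_isTopologicalBasis (n : ℕ) :
    TopologicalSpace.IsTopologicalBasis
      { U | ∃ p : MvPolynomial (Fin n) ℂ, U = { x : Fin n → ℂ | eval x p ≠ 0 } } := by
  refine TopologicalSpace.isTopologicalBasis_of_subbasis_of_finiteInter rfl ⟨⟨1, by simp⟩, ?_⟩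
  rintro _ ⟨p, rfl⟩ _ ⟨q, rfl⟩
  refine ⟨p * q, ?_⟩
  ext x
  simp

theorem isOpen_basic {n : ℕ} (p : MvPolynomial (Fin n) ℂ) :
    IsOpen { x : Fin n → ℂ | eval x p ≠ 0 } :=
  (pzar_isTopologicalBasis n).isOpen ⟨p, rfl⟩

theorem closure_eq_zeroLocus {n : ℕ} (S : Set (Fin n → ℂ)) :
    closure S = zeroLocus ℂ (idealOf S) := by
  ext x
  rw [(pzar_isTopologicalBasis n).mem_closure_iff, mem_zeroLocus_iff]
  constructor
  · intro h p hp
    by_contra hx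
    obtain ⟨z, hz, hzS⟩ := h _ ⟨p, rfl⟩ hx
    exact hz (mem_idealOf.1 hp z hzS)
  · rintro h _ ⟨p, rfl⟩ hx
    by_contra hS
    refine hx (h p (mem_idealOf.2 fun z hz => ?_))
    by_contra hz'
    exact hS ⟨z, hz', hz⟩

theorem isClosed_zeroLocus {n : ℕ} (I : Ideal (MvPolynomial (Fin n) ℂ)) :
    IsClosed (zeroLocus ℂ I) := by
  rw [← closure_subset_iff_isClosed, closure_eq_zeroLocus]
  exact zeroLocus_anti_mono (le_vanishingIdeal_zeroLocus I)

theorem isIrreducibleP_iff {n : ℕ} {S : Set (Fin n → ℂ)} :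
    isIrreducibleP S ↔ (idealOf S).IsPrime := by
  constructor
  · intro h
    obtain ⟨⟨x, hx⟩, h⟩ := h
    refine ⟨fun h1 => ?_, fun {p q} hpq => ?_⟩
    · have := mem_idealOf.1 ((Ideal.eq_top_iff_one _).1 h1) x hx
      simp at this
    · by_contra! hne
      rw [mem_idealOf, mem_idealOf] at hne
      push Not at hne
      obtain ⟨⟨y, hy, hyp⟩, z, hz, hzq⟩ := hne
      obtain ⟨w, hw, hwp, hwq⟩ := h _ _ (isOpen_basic p) (isOpen_basic q) ⟨y, hy, hyp⟩ ⟨z, hz, hzq⟩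
      have := mem_idealOf.1 hpq w hw
      rw [map_mul] at this
      exact (mul_ne_zero hwp hwq) this
  · intro h
    refine ⟨?_, ?_⟩
    · by_contra hS
      rw [Set.not_nonempty_iff_eq_empty] at hS
      subst hS
      exact h.ne_top (vanishingIdeal_empty)
    · rintro u v hu hv ⟨y, hy, hyu⟩ ⟨z, hz, hzv⟩
      obtain ⟨_, ⟨p, rfl⟩, hyp, hpu⟩ := (pzar_isTopologicalBasis n).exists_subset_of_mem_open hyu hu
      obtain ⟨_, ⟨q, rfl⟩, hzq, hqv⟩ := (pzar_isTopologicalBasis n).exists_subset_of_mem_open hzv hv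
      by_contra hne
      have hpq : p * q ∈ idealOf S := mem_idealOf.2 fun w hw => by
        by_contra hw'
        rw [map_mul, mul_eq_zero, not_or] at hw'
        exact hne ⟨w, hw, hpu hw'.1, hqv hw'.2⟩
      rcases h.mem_or_mem hpq with hp | hq
      · exact hyp (mem_idealOf.1 hp y hy)
      · exact hzq (mem_idealOf.1 hq z hz)

instance (n : ℕ) : TopologicalSpace.NoetherianSpace (Fin n → ℂ) := by
  refine ((TopologicalSpace.noetherianSpace_TFAE (Fin n → ℂ)).out 0 1).2 ?_
  have : StrictAnti fun C : TopologicalSpace.Closeds (Fin n → ℂ) =>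
      idealOf (C : Set (Fin n → ℂ)) := by
    refine Antitone.strictAnti_of_injective (fun C D h => vanishingIdeal_anti_mono h) ?_
    intro C D h
    apply SetLike.coe_injective
    rw [← C.isClosed.closure_eq, ← D.isClosed.closure_eq]
    refine (closure_eq_zeroLocus _).trans (Eq.trans ?_ (closure_eq_zeroLocus _).symm)
    exact congrArg (zeroLocus ℂ) h
  exact this.wellFoundedLT

/-- A set contains, around each of its points, a basic open subset of its closure. -/
def IsOpenInClosure {n : ℕ} (S : Set (Fin n → ℂ)) : Prop :=
  ∀ x ∈ S, ∃ h : MvPolynomial (Fin n) ℂ, eval x h ≠ 0 ∧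
    ∀ z ∈ zeroLocus ℂ (idealOf S), eval z h ≠ 0 → z ∈ S

theorem isLocallyClosedP.isOpenInClosure {n : ℕ} {S : Set (Fin n → ℂ)}
    (hS : isLocallyClosedP S) : IsOpenInClosure S := by
  intro x hx
  have hS' : IsLocallyClosed S := hS
  have hx' : x ∈ coborder S := subset_coborder hx
  obtain ⟨_, ⟨h, rfl⟩, hxh, hS⟩ :=
    (pzar_isTopologicalBasis n).exists_subset_of_mem_open hx' hS'.isOpen_coborder
  refine ⟨h, hxh, fun z hz hzh => ?_⟩
  rw [← closure_eq_zeroLocus] at hz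
  have : z ∈ closure S ∩ coborder S := ⟨hz, hS hzh⟩
  rwa [closure_inter_coborder] at this

theorem IsOpenInClosure.inter_zeroLocus {n : ℕ} {S T : Set (Fin n → ℂ)} (hS : IsOpenInClosure S)
    (hTS : T ⊆ S) (hT : ∀ x ∈ S, x ∈ zeroLocus ℂ (idealOf T) → x ∈ T) : IsOpenInClosure T := by
  intro x hx
  obtain ⟨h, hxh, hh⟩ := hS x (hTS hx)
  exact ⟨h, hxh, fun z hz hzh =>
    hT z (hh z (zeroLocus_anti_mono (vanishingIdeal_anti_mono hTS) hz) hzh) hz⟩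

theorem idealOf_eq_of_subset_zeroLocus {n : ℕ} {S T : Set (Fin n → ℂ)} (hST : S ⊆ T)
    (h : T ⊆ zeroLocus ℂ (idealOf S)) : idealOf T = idealOf S :=
  le_antisymm (vanishingIdeal_anti_mono hST) fun _ hp _ hx => h hx _ hp

theorem dimP_le {n : ℕ} {S : Set (Fin n → ℂ)} (hS : isIrreducibleP S) :
    dimP S ≤ ((quotientTrdeg (idealOf S) : ℕ∞) : WithBot ℕ∞) := by
  have := isIrreducibleP_iff.1 hS
  rw [← ringKrullDim_quotient_eq, ringKrullDim]
  change topologicalKrullDim S ≤ _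
  rw [topologicalKrullDim, ← Order.krullDim_orderDual (α := PrimeSpectrum _)]
  have hirr (T : TopologicalSpace.IrreducibleCloseds S) :
      (idealOf (Subtype.val '' (T : Set S))).IsPrime :=
    isIrreducibleP_iff.1 (T.isIrreducible.image Subtype.val continuous_subtype_val.continuousOn)
  have hle (T : TopologicalSpace.IrreducibleCloseds S) :
      idealOf S ≤ idealOf (Subtype.val '' (T : Set S)) := by
    apply vanishingIdeal_anti_mono
    rintro _ ⟨x, -, rfl⟩
    exact x.2
  have hcomap (T : TopologicalSpace.IrreducibleCloseds S) :=
    Ideal.comap_map_of_surjective' (Ideal.Quotient.mk (idealOf S)) Ideal.Quotient.mk_surjective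
      (idealOf (Subtype.val '' (T : Set S)))
  simp only [Ideal.mk_ker, sup_of_le_left (hle _)] at hcomap
  refine Order.krullDim_le_of_strictMono (fun T => OrderDual.toDual
    ⟨(idealOf (Subtype.val '' (T : Set S))).map (Ideal.Quotient.mk (idealOf S)),
      Ideal.map_isPrime_of_surjective Ideal.Quotient.mk_surjective (by simpa using hle T)⟩) ?_
  refine Monotone.strictMono_of_injective ?_ ?_
  · intro T U h
    exact Ideal.map_mono (vanishingIdeal_anti_mono (Set.image_mono h))
  · intro T U h
    have h1 : idealOf (Subtype.val '' (T : Set S)) =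
        idealOf (Subtype.val '' (U : Set S)) := by
      rw [← hcomap T, ← hcomap U]
      exact congrArg (fun p => Ideal.comap _ (PrimeSpectrum.asIdeal (OrderDual.ofDual p))) h
    apply SetLike.coe_injective
    have hind := Topology.IsInducing.subtypeVal (t := (S : Set (Fin n → ℂ)))
    rw [← T.isClosed.closure_eq, ← U.isClosed.closure_eq, hind.closure_eq_preimage_closure_image,
      hind.closure_eq_preimage_closure_image]
    congr 1
    refine (closure_eq_zeroLocus _).trans (Eq.trans ?_ (closure_eq_zeroLocus _).symm)
    rw [h1]

theorem le_dimP {n : ℕ} {S : Set (Fin n → ℂ)} (hS : isIrreducibleP S) (hS' : IsOpenInClosure S) :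
    ((quotientTrdeg (idealOf S) : ℕ∞) : WithBot ℕ∞) ≤ dimP S := by
  have := isIrreducibleP_iff.1 hS
  obtain ⟨x, hx⟩ := hS.1
  obtain ⟨h, hxh, hh⟩ := hS' x hx
  have hhS : h ∉ idealOf S := fun h1 => hxh (mem_idealOf.1 h1 x hx)
  rw [← ringKrullDim_localizationAway_eq _ hhS, ringKrullDim]
  change _ ≤ topologicalKrullDim S
  rw [topologicalKrullDim, ← Order.krullDim_orderDual (α := PrimeSpectrum _)]
  set L := Localization.Away (Ideal.Quotient.mk (idealOf S) h)
  let c (Q : PrimeSpectrum L) : PrimeSpectrum (MvPolynomial (Fin n) ℂ) :=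
    PrimeSpectrum.comap (Ideal.Quotient.mk (idealOf S)) (PrimeSpectrum.comap (algebraMap _ L) Q)
  have hcinj : Function.Injective c :=
    (PrimeSpectrum.comap_injective_of_surjective _ Ideal.Quotient.mk_surjective).comp
      (PrimeSpectrum.localization_comap_injective L
        (Submonoid.powers (Ideal.Quotient.mk (idealOf S) h)))
  have hhc (Q) : h ∉ (c Q).asIdeal := fun h1 => Q.2.ne_top (Ideal.eq_top_of_isUnit_mem _ h1
    (IsLocalization.Away.algebraMap_isUnit _))
  have hSc (Q) : idealOf S ≤ (c Q).asIdeal := fun p hp => by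
    change algebraMap _ L (Ideal.Quotient.mk _ p) ∈ Q.asIdeal
    rw [Ideal.Quotient.eq_zero_iff_mem.2 hp, map_zero]
    exact zero_mem _
  have hI (Q) : idealOf (S ∩ zeroLocus ℂ (c Q).asIdeal) = (c Q).asIdeal := by
    apply le_antisymm
    · intro p hp
      have : p * h ∈ vanishingIdeal ℂ (zeroLocus ℂ (c Q).asIdeal) := by
        intro z hz
        rw [map_mul, mul_eq_zero, or_iff_not_imp_right]
        intro hzh
        exact hp z ⟨hh z (zeroLocus_anti_mono (hSc Q) hz) hzh, hz⟩
      rw [MvPolynomial.IsPrime.vanishingIdeal_zeroLocus] at this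
      exact ((c Q).2.mem_or_mem this).resolve_right (hhc Q)
    · exact fun p hp z hz => hz.2 p hp
  let V (Q : PrimeSpectrum L) : Set S :=
    Subtype.val ⁻¹' (zeroLocus ℂ (c Q).asIdeal)
  have hV (Q) : Subtype.val '' (V Q) = S ∩ zeroLocus ℂ (c Q).asIdeal :=
    Subtype.image_preimage_coe _ _
  have hVirr (Q) : IsIrreducible (V Q) := by
    have h1 : IsIrreducible (S ∩ zeroLocus ℂ (c Q).asIdeal) :=
      isIrreducibleP_iff.2 (by rw [hI]; exact (c Q).2)
    rw [← hV] at h1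
    refine ⟨h1.1.of_image, ?_⟩
    rintro _ _ ⟨u, hu, rfl⟩ ⟨v, hv, rfl⟩ ⟨y, hy, hyu⟩ ⟨z, hz, hzv⟩
    obtain ⟨_, ⟨w, hw, rfl⟩, hwu, hwv⟩ := h1.2 u v hu hv ⟨y, ⟨y, hy, rfl⟩, hyu⟩
      ⟨z, ⟨z, hz, rfl⟩, hzv⟩
    exact ⟨w, hw, hwu, hwv⟩
  refine Order.krullDim_le_of_strictMono (fun Q => (⟨V (OrderDual.ofDual Q), hVirr _,
    (isClosed_zeroLocus _).preimage continuous_subtype_val⟩ :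
      TopologicalSpace.IrreducibleCloseds S)) ?_
  refine Monotone.strictMono_of_injective ?_ ?_
  · intro Q R hQR
    change V (OrderDual.ofDual Q) ⊆ V (OrderDual.ofDual R)
    apply Set.preimage_mono
    apply zeroLocus_anti_mono
    exact Ideal.comap_mono (Ideal.comap_mono hQR)
  · intro Q R hQR
    apply OrderDual.ofDual.injective
    apply hcinj
    apply PrimeSpectrum.ext
    have h2 := congrArg TopologicalSpace.IrreducibleCloseds.carrier hQR
    have h3 := congrArg (fun T : Set S => idealOf (Subtype.val '' T)) h2
    change idealOf (Subtype.val '' V _) = idealOf (Subtype.val '' V _) at h3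
    rwa [hV, hV, hI, hI] at h3

theorem dimP_eq {n : ℕ} {S : Set (Fin n → ℂ)} (hS : isIrreducibleP S) (hS' : IsOpenInClosure S) :
    dimP S = ((quotientTrdeg (idealOf S) : ℕ∞) : WithBot ℕ∞) :=
  (dimP_le hS).antisymm (le_dimP hS hS')

theorem mem_of_mem_irrCompsP {n : ℕ} {X C : Set (Fin n → ℂ)} (hC : C ∈ irrCompsP X)
    {x : Fin n → ℂ} (hx : x ∈ X) (hxC : x ∈ zeroLocus ℂ (idealOf C)) : x ∈ C := by
  have hI : idealOf (X ∩ zeroLocus ℂ (idealOf C)) = idealOf C :=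
    idealOf_eq_of_subset_zeroLocus
      (fun z hz => ⟨hC.1 hz, zeroLocus_vanishingIdeal_le C hz⟩) Set.inter_subset_right
  have h := hC.2.2 (X ∩ zeroLocus ℂ (idealOf C)) Set.inter_subset_left
    (isIrreducibleP_iff.2 (by rw [hI]; exact isIrreducibleP_iff.1 hC.2.1))
    (fun z hz => ⟨hC.1 hz, zeroLocus_vanishingIdeal_le C hz⟩)
  rw [← h]
  exact ⟨hx, hxC⟩

theorem IsOpenInClosure.of_mem_irrCompsP {n : ℕ} {X C : Set (Fin n → ℂ)}
    (hX : IsOpenInClosure X) (hC : C ∈ irrCompsP X) : IsOpenInClosure C :=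
  hX.inter_zeroLocus hC.1 fun _ => mem_of_mem_irrCompsP hC

theorem exists_mem_irrCompsP_superset {n : ℕ} {X Z : Set (Fin n → ℂ)} (hZX : Z ⊆ X)
    (hZ : isIrreducibleP Z) : ∃ C ∈ irrCompsP X, Z ⊆ C := by
  let A : Set ℕ := {m | ∃ T, Z ⊆ T ∧ T ⊆ X ∧ isIrreducibleP T ∧ quotientTrdeg (idealOf T) = m}
  have hA : A.Nonempty := ⟨_, Z, le_rfl, hZX, hZ, rfl⟩
  have hbdd : BddAbove A := by
    refine ⟨quotientTrdeg (⊥ : Ideal (MvPolynomial (Fin n) ℂ)), ?_⟩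
    rintro _ ⟨T, -, -, hT, rfl⟩
    have := isIrreducibleP_iff.1 hT
    exact quotientTrdeg_anti bot_le
  obtain ⟨T, hZT, hTX, hT, hTm⟩ := Nat.sSup_mem hA hbdd
  have hTprime := isIrreducibleP_iff.1 hT
  have hI : idealOf (X ∩ zeroLocus ℂ (idealOf T)) = idealOf T :=
    idealOf_eq_of_subset_zeroLocus
      (fun z hz => ⟨hTX hz, zeroLocus_vanishingIdeal_le T hz⟩) Set.inter_subset_right
  refine ⟨X ∩ zeroLocus ℂ (idealOf T), ⟨Set.inter_subset_left,
    isIrreducibleP_iff.2 (by rwa [hI]), ?_⟩,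
    fun z hz => ⟨hZX hz, zeroLocus_vanishingIdeal_le T (hZT hz)⟩⟩
  intro C' hC'X hC' hle
  have hC'prime := isIrreducibleP_iff.1 hC'
  refine Set.Subset.antisymm (fun z hz => ⟨hC'X hz, ?_⟩) hle
  have hTC' : T ⊆ C' := fun z hz => hle ⟨hTX hz, zeroLocus_vanishingIdeal_le T hz⟩
  have h1 : quotientTrdeg (idealOf C') ≤ quotientTrdeg (idealOf T) := by
    rw [hTm]
    exact le_csSup hbdd ⟨C', hZT.trans hTC', hC'X, hC', rfl⟩
  have h2 : idealOf T = idealOf C' :=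
    eq_of_le_of_quotientTrdeg_le (vanishingIdeal_anti_mono hTC') h1
  rw [h2]
  exact zeroLocus_vanishingIdeal_le C' hz

theorem exists_finite_irrCompsP_cover {n : ℕ} (X : Set (Fin n → ℂ)) :
    ∃ s : Finset (Set (Fin n → ℂ)), (∀ C ∈ s, C ∈ irrCompsP X) ∧ ∀ x ∈ X, ∃ C ∈ s, x ∈ C := by
  classical
  obtain ⟨S, hSf, -, hS, hSX⟩ :=
    TopologicalSpace.NoetherianSpace.exists_finite_set_isClosed_irreducible
      (isClosed_univ (X := X))
  have h (T : Set X) : ∃ C, T ∈ S → C ∈ irrCompsP X ∧ Subtype.val '' T ⊆ C := by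
    by_cases hT : T ∈ S
    · obtain ⟨C, hC, hTC⟩ := exists_mem_irrCompsP_superset (X := X) (Z := Subtype.val '' T)
        (by rintro _ ⟨x, -, rfl⟩; exact x.2)
        ((hS T hT).image Subtype.val continuous_subtype_val.continuousOn)
      exact ⟨C, fun _ => ⟨hC, hTC⟩⟩
    · exact ⟨∅, fun h => absurd h hT⟩
  choose C hC using h
  refine ⟨hSf.toFinset.image C, ?_, ?_⟩
  · intro D hD
    obtain ⟨T, hT, rfl⟩ := Finset.mem_image.1 hD
    exact (hC T (hSf.mem_toFinset.1 hT)).1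
  · intro x hx
    have : (⟨x, hx⟩ : X) ∈ ⋃₀ S := hSX ▸ Set.mem_univ _
    obtain ⟨T, hT, hxT⟩ := this
    exact ⟨C T, Finset.mem_image_of_mem _ (hSf.mem_toFinset.2 hT), (hC T hT).2 ⟨_, hxT, rfl⟩⟩

theorem isIrreducibleP.exists_idealOf_le {n : ℕ} {S : Set (Fin n → ℂ)} (hS : isIrreducibleP S)
    {ι : Type*} (s : Finset ι) (T : ι → Set (Fin n → ℂ)) (h : ∀ x ∈ S, ∃ i ∈ s, x ∈ T i) :
    ∃ i ∈ s, idealOf (T i) ≤ idealOf S := by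
  have := isIrreducibleP_iff.1 hS
  rw [← Ideal.IsPrime.inf_le' this]
  intro p hp
  rw [Submodule.mem_finsetInf] at hp
  rw [mem_idealOf]
  intro x hx
  obtain ⟨i, hi, hxi⟩ := h x hx
  exact mem_idealOf.1 (hp i hi) x hxi

theorem exists_irrCompsP_of_irreducible_subset {n : ℕ} {X S : Set (Fin n → ℂ)}
    {s : Finset (Set (Fin n → ℂ))} (hs : ∀ C ∈ s, C ∈ irrCompsP X)
    (hsX : ∀ x ∈ X, ∃ C ∈ s, x ∈ C) (hSX : S ⊆ X) (hS : isIrreducibleP S) :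
    ∃ C ∈ s, S ⊆ C := by
  obtain ⟨C, hC, h⟩ := hS.exists_idealOf_le s id fun x hx => hsX x (hSX hx)
  exact ⟨C, hC, fun x hx => mem_of_mem_irrCompsP (hs C hC) (hSX hx)
    (zeroLocus_anti_mono h (zeroLocus_vanishingIdeal_le S hx))⟩

theorem eval_aeval_eq {a b : ℕ} (F : Fin b → MvPolynomial (Fin a) ℂ) (x : Fin a → ℂ)
    (p : MvPolynomial (Fin b) ℂ) :
    eval x (aeval F p) = eval (fun j => eval x (F j)) p := by
  have := aeval_bind₁ (R := ℂ) x F p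
  simpa only [aeval_eq_bind₁, aeval_eq_eval] using this

theorem idealOf_image {a b : ℕ} (F : Fin b → MvPolynomial (Fin a) ℂ) (Z : Set (Fin a → ℂ)) :
    idealOf ((fun x j => eval x (F j)) '' Z) = (idealOf Z).comap (aeval F) := by
  ext p
  rw [Ideal.mem_comap, mem_idealOf, mem_idealOf, Set.forall_mem_image]
  simp_rw [eval_aeval_eq]

theorem exists_basicOpen_subset_or {A : Type*} [CommRing A] [IsDomain A]
    {s : Set (PrimeSpectrum A)} (hs : Topology.IsConstructible s) :
    (∃ c ≠ (0 : A), (PrimeSpectrum.basicOpen c : Set (PrimeSpectrum A)) ⊆ s) ∨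
      ∃ c ≠ (0 : A), (PrimeSpectrum.basicOpen c : Set (PrimeSpectrum A)) ⊆ sᶜ := by
  induction hs using Topology.IsConstructible.empty_union_induction with
  | open_retrocompact U hU _ =>
    rcases U.eq_empty_or_nonempty with rfl | ⟨x, hx⟩
    · exact Or.inr ⟨1, one_ne_zero, by simp⟩
    · left
      obtain ⟨_, ⟨_, ⟨c, rfl⟩, rfl⟩, hxc, hc⟩ :=
        PrimeSpectrum.isBasis_basic_opens.exists_subset_of_mem_open hx hU
      exact ⟨c, fun h0 => by simp [h0] at hxc, hc⟩
  | union s _ t _ hs ht =>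
    rcases hs with ⟨c, hc, hcs⟩ | ⟨c, hc, hcs⟩
    · exact Or.inl ⟨c, hc, hcs.trans Set.subset_union_left⟩
    rcases ht with ⟨c', hc', hct⟩ | ⟨c', hc', hct⟩
    · exact Or.inl ⟨c', hc', hct.trans Set.subset_union_right⟩
    · refine Or.inr ⟨c * c', mul_ne_zero hc hc', ?_⟩
      rw [Set.compl_union, PrimeSpectrum.basicOpen_mul]
      exact Set.inter_subset_inter hcs hct
  | compl s _ h =>
    rw [compl_compl]
    exact h.symm

theorem exists_forall_mem_range_comap {A B : Type*} [CommRing A] [CommRing B] [IsDomain A]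
    [IsDomain B] {φ : A →+* B} (hφ : φ.FinitePresentation) (hi : Function.Injective φ) :
    ∃ c ≠ (0 : A), ∀ p : PrimeSpectrum A, c ∉ p.asIdeal → ∃ q, PrimeSpectrum.comap φ q = p := by
  have hbot : (⊥ : PrimeSpectrum A) ∈ Set.range (PrimeSpectrum.comap φ) :=
    ⟨⊥, PrimeSpectrum.ext (by
      change Ideal.comap φ ⊥ = ⊥
      rw [← RingHom.ker_eq_comap_bot, (RingHom.injective_iff_ker_eq_bot _).1 hi])⟩
  rcases exists_basicOpen_subset_or (PrimeSpectrum.isConstructible_range_comap hφ) with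
    ⟨c, hc, h⟩ | ⟨c, hc, h⟩
  · exact ⟨c, hc, fun p hp => h hp⟩
  · exact absurd hbot (h (by simpa using hc))

theorem IsTranscendenceBasis.exists_eval₂_eq_zero {A B ι : Type*} [CommRing A] [CommRing B]
    [IsDomain B] [Algebra A B] [FaithfulSMul A B] {s : ι → B}
    (hs : IsTranscendenceBasis A s) (x : B) :
    ∃ p : Polynomial (MvPolynomial ι A), p ≠ 0 ∧
      p.eval₂ (aeval s : MvPolynomial ι A →ₐ[A] B).toRingHom x = 0 := by
  have : IsDomain A := (FaithfulSMul.algebraMap_injective A B).isDomain _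
  have := hs.isAlgebraic
  obtain ⟨p, hp, hpx⟩ := Algebra.IsAlgebraic.isAlgebraic (R := Algebra.adjoin A (Set.range s)) x
  let g := hs.1.aevalEquiv.symm.toAlgHom.toRingHom
  refine ⟨p.map g, ?_, ?_⟩
  · rwa [Ne, Polynomial.map_eq_zero_iff]
    exact hs.1.aevalEquiv.symm.injective
  · rw [Polynomial.eval₂_map, ← hpx, Polynomial.aeval_def]
    congr 1
    refine RingHom.ext fun r => ?_
    change aeval s (hs.1.aevalEquiv.symm r) = algebraMap _ B r
    rw [← hs.1.algebraMap_aevalEquiv]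
    simp

theorem exists_generic_fibre {a b : ℕ} (F : Fin b → MvPolynomial (Fin a) ℂ) {Z : Set (Fin a → ℂ)}
    (hZ : isIrreducibleP Z) (hZ' : IsOpenInClosure Z) :
    ∃ (e : ℕ) (t : Fin e → MvPolynomial (Fin a) ℂ) (c : MvPolynomial (Fin b) ℂ),
      c ∉ idealOf ((fun x j => eval x (F j)) '' Z) ∧
      quotientTrdeg (idealOf Z) = quotientTrdeg (idealOf ((fun x j => eval x (F j)) '' Z)) + e ∧
      ∀ y ∈ zeroLocus ℂ (idealOf ((fun x j => eval x (F j)) '' Z)), eval y c ≠ 0 →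
        (∀ q : MvPolynomial (Fin e) ℂ,
          aeval t q ∈ idealOf {x ∈ Z | (fun j => eval x (F j)) = y} → q = 0) ∧
        ∀ j, ∃ p : Polynomial (MvPolynomial (Fin e) ℂ), p ≠ 0 ∧
          p.eval₂ (aeval t : MvPolynomial (Fin e) ℂ →ₐ[ℂ] MvPolynomial (Fin a) ℂ).toRingHom (X j) ∈
            idealOf {x ∈ Z | (fun j => eval x (F j)) = y} := by
  classical
  have hP := isIrreducibleP_iff.1 hZ
  set P := idealOf Z with hPdef
  have hI : idealOf ((fun x j => eval x (F j)) '' Z) = P.comap (aeval F) := idealOf_image F Z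
  set I := idealOf ((fun x j => eval x (F j)) '' Z) with hIdef
  have hIp : I.IsPrime := by rw [hI]; infer_instance
  let A := MvPolynomial (Fin b) ℂ ⧸ I
  let B := MvPolynomial (Fin a) ℂ ⧸ P
  let φ : A →ₐ[ℂ] B := Ideal.quotientMapₐ P (aeval F) hI.le
  have hφ : Function.Injective φ := Ideal.quotientMap_injective' (H := hI.le) hI.ge
  have hφmk (p) : φ (Ideal.Quotient.mk I p) = Ideal.Quotient.mk P (aeval F p) := rfl
  let : Algebra A B := φ.toRingHom.toAlgebra
  have : IsScalarTower ℂ A B := IsScalarTower.of_algebraMap_eq' (φ.comp_algebraMap).symm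
  have : FaithfulSMul A B := (faithfulSMul_iff_algebraMap_injective _ _).2 hφ
  have htr := trdeg_add_eq ℂ A (A := B)
  rw [trdeg_quotient_eq, trdeg_quotient_eq] at htr
  have hfin : Algebra.trdeg A B < Cardinal.aleph0 :=
    lt_of_le_of_lt (le_add_self.trans htr.le) (Cardinal.natCast_lt_aleph0)
  obtain ⟨e, he⟩ := Cardinal.lt_aleph0.1 hfin
  rw [he] at htr
  obtain ⟨s₀, hs₀⟩ := exists_isTranscendenceBasis A B
  have hs₀c := hs₀.cardinalMk_eq_trdeg
  rw [he, ← Cardinal.mk_fin] at hs₀c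
  obtain ⟨g⟩ : Nonempty (Fin e ≃ s₀) := by
    rw [← Cardinal.eq]
    simpa using hs₀c.symm
  choose t ht using fun i => Ideal.Quotient.mk_surjective (I := P) (g i : B)
  have hs : IsTranscendenceBasis A (fun i => Ideal.Quotient.mk P (t i) : Fin e → B) := by
    simp_rw [ht]
    exact hs₀.comp_equiv g
  set s : Fin e → B := fun i => Ideal.Quotient.mk P (t i) with hsdef
  choose p hp0 hp using fun j : Fin a =>
    IsTranscendenceBasis.exists_eval₂_eq_zero hs (Ideal.Quotient.mk P (X j))
  obtain ⟨x₀, hx₀⟩ := hZ.1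
  obtain ⟨h, hx₀h, hh⟩ := hZ' x₀ hx₀
  have hhP : h ∉ P := fun h1 => hx₀h (mem_idealOf.1 h1 x₀ hx₀)
  have h0 : Ideal.Quotient.mk P h ≠ 0 := by rwa [Ne, Ideal.Quotient.eq_zero_iff_mem]
  have hle := powers_le_nonZeroDivisors_of_noZeroDivisors h0
  obtain ⟨L, _, _, _⟩ : ∃ (L : Type) (_ : CommRing L) (_ : Algebra B L),
      IsLocalization.Away (Ideal.Quotient.mk P h) L :=
    ⟨Localization.Away (Ideal.Quotient.mk P h), inferInstance, inferInstance, inferInstance⟩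
  have : IsDomain L := IsLocalization.isDomain_of_le_nonZeroDivisors L hle
  have : Algebra.FiniteType B L :=
    IsLocalization.finiteType_of_monoid_fg (Submonoid.powers (Ideal.Quotient.mk P h)) _
  let ψ : MvPolynomial (Fin e) A →+* L := (algebraMap B L).comp (aeval s).toRingHom
  have hψi : Function.Injective ψ := (IsLocalization.injective L hle).comp hs.1
  have hψf : RingHom.FinitePresentation (A := MvPolynomial (Fin e) A) (B := L) ψ := by
    rw [← RingHom.FinitePresentation.of_finiteType]
    apply RingHom.FiniteType.of_comp_finiteType (f := C.comp (algebraMap ℂ A))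
    have : ψ.comp (C.comp (algebraMap ℂ A)) = (algebraMap B L).comp (algebraMap ℂ B) := by
      ext r
      change algebraMap B L (aeval s (C (algebraMap ℂ A r))) = _
      rw [aeval_C, ← IsScalarTower.algebraMap_apply ℂ A B]
      rfl
    rw [this]
    exact ((RingHom.finiteType_algebraMap).2 inferInstance).comp
      ((RingHom.finiteType_algebraMap).2 inferInstance)
  obtain ⟨c, hc0, hc⟩ := exists_forall_mem_range_comap hψf hψi
  have hcoeff (r : MvPolynomial (Fin e) A) (hr : r ≠ 0) : ∃ u : MvPolynomial (Fin b) ℂ,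
      u ∉ I ∧ ∃ m, coeff m r = Ideal.Quotient.mk I u := by
    obtain ⟨m, hm⟩ := ne_zero_iff.1 hr
    obtain ⟨u, hu⟩ := Ideal.Quotient.mk_surjective (coeff m r)
    exact ⟨u, fun h1 => hm (by rw [← hu, Ideal.Quotient.eq_zero_iff_mem.2 h1]), m, hu.symm⟩
  obtain ⟨c₁, hc₁, m₁, hm₁⟩ := hcoeff c hc0
  choose u hu m hm using fun j =>
    hcoeff (p j).leadingCoeff (Polynomial.leadingCoeff_ne_zero.2 (hp0 j))
  refine ⟨e, t, c₁ * ∏ j, u j, ?_, ?_, ?_⟩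
  · rw [hIp.mul_mem_iff_mem_or_mem, hIp.prod_mem_iff]
    simpa [hc₁] using hu
  · exact_mod_cast htr.symm
  intro y hy hyc
  rw [map_mul, map_prod, mul_ne_zero_iff, Finset.prod_ne_zero_iff] at hyc
  let ε : A →+* ℂ := Ideal.Quotient.lift I (eval y) fun r hr => hy r hr
  have hεmk (r) : ε (Ideal.Quotient.mk I r) = eval y r := rfl
  constructor
  · intro q hq
    by_contra hq0
    have hcy : MvPolynomial.map ε c ≠ 0 := fun h1 => by
      have := congrArg (coeff m₁) h1
      rw [coeff_map, hm₁, hεmk, coeff_zero] at this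
      exact hyc.1 this
    obtain ⟨τ, hτ⟩ : ∃ τ, eval τ (MvPolynomial.map ε c * q) ≠ 0 := by
      by_contra! h1
      exact mul_ne_zero hcy hq0 (MvPolynomial.funext fun τ => by rw [h1, map_zero])
    rw [map_mul, mul_ne_zero_iff, eval_map] at hτ
    let χ : MvPolynomial (Fin e) A →+* ℂ := eval₂Hom ε τ
    obtain ⟨Q, hQ⟩ := hc ⟨RingHom.ker χ, RingHom.ker_isPrime _⟩ (fun h1 => hτ.1 h1)
    have hQmem (r) : ψ r ∈ Q.asIdeal ↔ χ r = 0 := by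
      have := congrArg (fun p => r ∈ PrimeSpectrum.asIdeal p) hQ
      exact iff_of_eq this
    let Q' : Ideal (MvPolynomial (Fin a) ℂ) :=
      Q.asIdeal.comap ((algebraMap B L).comp (Ideal.Quotient.mk P))
    have hhQ : h ∉ Q' := fun h1 => Q.2.ne_top (Ideal.eq_top_of_isUnit_mem _ h1
      (IsLocalization.Away.algebraMap_isUnit _))
    have hPQ : P ≤ Q' := fun r hr => by
      change algebraMap B L (Ideal.Quotient.mk P r) ∈ Q.asIdeal
      rw [Ideal.Quotient.eq_zero_iff_mem.2 hr, map_zero]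
      exact zero_mem _
    obtain ⟨x, hxQ, hxh⟩ : ∃ x ∈ zeroLocus ℂ Q', eval x h ≠ 0 := by
      by_contra! h1
      apply hhQ
      rw [← MvPolynomial.IsPrime.vanishingIdeal_zeroLocus (K := ℂ) Q']
      exact h1
    have hxZ : x ∈ Z := hh x (zeroLocus_anti_mono hPQ hxQ) hxh
    have hxy : (fun j => eval x (F j)) = y := by
      ext j
      have h1 : F j - C (y j) ∈ Q' := by
        have h2 : ψ (C (Ideal.Quotient.mk I (X j - C (y j)))) ∈ Q.asIdeal := by
          rw [hQmem]
          simp [χ, hεmk]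
        have h4 : ψ (C (Ideal.Quotient.mk I (X j - C (y j)))) =
            algebraMap B L (Ideal.Quotient.mk P (F j - C (y j))) := by
          change algebraMap B L (aeval s (C _)) = _
          rw [aeval_C]
          change algebraMap B L (φ _) = _
          rw [hφmk, map_sub, aeval_X, aeval_C]
          rfl
        rwa [h4] at h2
      have := hxQ _ h1
      simpa [sub_eq_zero] using this
    have hxt (i) : eval x (t i) = τ i := by
      have h1 : t i - C (τ i) ∈ Q' := by
        have h2 : ψ (X i - C (Ideal.Quotient.mk I (C (τ i)))) ∈ Q.asIdeal := by
          rw [hQmem]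
          simp [χ, hεmk]
        have h4 : ψ (X i - C (Ideal.Quotient.mk I (C (τ i)))) =
            algebraMap B L (Ideal.Quotient.mk P (t i - C (τ i))) := by
          change algebraMap B L (aeval s (X i - C _)) = _
          rw [map_sub, aeval_X, aeval_C, map_sub (Ideal.Quotient.mk P)]
          change algebraMap B L (s i - φ _) = _
          rw [hφmk, aeval_C]
          rfl
        rwa [h4] at h2
      have := hxQ _ h1
      simpa [sub_eq_zero] using this
    have h3 := mem_idealOf.1 hq x ⟨hxZ, hxy⟩
    rw [eval_aeval_eq] at h3
    simp_rw [hxt] at h3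
    exact hτ.2 h3
  · intro j
    refine ⟨(p j).map (MvPolynomial.map ε), fun h1 => ?_, ?_⟩
    · have := congrArg (fun r => coeff (m j) (Polynomial.coeff r (p j).natDegree)) h1
      simp only [Polynomial.coeff_map, Polynomial.coeff_natDegree, coeff_map, hm, hεmk] at this
      exact hyc.2 j (Finset.mem_univ _) (by simpa using this)
    · rw [mem_idealOf]
      rintro x ⟨hxZ, hxy⟩
      let ε' : B →+* ℂ := Ideal.Quotient.lift P (eval x) fun r hr => mem_idealOf.1 hr x hxZ
      have h2 := congrArg ε' (hp j)
      rw [map_zero, Polynomial.hom_eval₂] at h2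
      rw [← h2, Polynomial.eval₂_map, Polynomial.hom_eval₂]
      congr 1
      apply MvPolynomial.ringHom_ext
      · intro r
        obtain ⟨r, rfl⟩ := Ideal.Quotient.mk_surjective r
        change eval x (aeval t (MvPolynomial.map ε (C _))) = ε' (aeval s (C _))
        rw [aeval_C, map_C, aeval_C]
        change _ = ε' (φ _)
        rw [hφmk, hεmk]
        change eval x (C _) = eval x (aeval F r)
        rw [eval_aeval_eq, hxy, eval_C]
      · intro i
        change eval x (aeval t (MvPolynomial.map ε (X i))) = ε' (aeval s (X i))
        rw [map_X, aeval_X, aeval_X]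
        rfl

theorem quotientTrdeg_eq_of_generators {n e : ℕ} {J : Ideal (MvPolynomial (Fin n) ℂ)} [J.IsPrime]
    {t : Fin e → MvPolynomial (Fin n) ℂ}
    (ht : ∀ q : MvPolynomial (Fin e) ℂ, aeval t q ∈ J → q = 0)
    (hX : ∀ j, ∃ p : Polynomial (MvPolynomial (Fin e) ℂ), p ≠ 0 ∧
      p.eval₂ (aeval t : MvPolynomial (Fin e) ℂ →ₐ[ℂ] MvPolynomial (Fin n) ℂ).toRingHom (X j) ∈ J) :
    quotientTrdeg J = e := by
  have hi := algebraicIndependent_quotient_mk_iff.2 ht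
  set s := fun i => Ideal.Quotient.mk J (t i) with hs
  have halg (p : MvPolynomial (Fin n) ℂ) :
      IsAlgebraic (Algebra.adjoin ℂ (Set.range s)) (Ideal.Quotient.mk J p) := by
    induction p using MvPolynomial.induction_on with
    | C r => exact isAlgebraic_algebraMap (algebraMap ℂ (Algebra.adjoin ℂ (Set.range s)) r)
    | add p q hp hq => rw [map_add]; exact hp.add hq
    | mul_X p j hp =>
      rw [map_mul]
      refine hp.mul ?_
      obtain ⟨p, hp, hpJ⟩ := hX j
      refine ⟨p.map hi.aevalEquiv.toAlgHom.toRingHom, ?_, ?_⟩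
      · rwa [Ne, Polynomial.map_eq_zero_iff]
        exact hi.aevalEquiv.injective
      · rw [Polynomial.aeval_def, Polynomial.eval₂_map, ← Ideal.Quotient.eq_zero_iff_mem.2 hpJ,
          Polynomial.hom_eval₂]
        congr 1
        apply MvPolynomial.ringHom_ext
        · intro r
          change algebraMap _ _ (hi.aevalEquiv (C r)) = Ideal.Quotient.mk J (aeval t (C r))
          rw [hi.algebraMap_aevalEquiv, aeval_C, aeval_C]
          rfl
        · intro i
          change algebraMap _ _ (hi.aevalEquiv (X i)) = Ideal.Quotient.mk J (aeval t (X i))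
          rw [hi.algebraMap_aevalEquiv, aeval_X, aeval_X]
  have hb : IsTranscendenceBasis ℂ s := by
    rw [hi.isTranscendenceBasis_iff_isAlgebraic]
    refine ⟨fun x => ?_⟩
    obtain ⟨p, rfl⟩ := Ideal.Quotient.mk_surjective x
    exact halg p
  have h := hb.cardinalMk_eq_trdeg
  rw [trdeg_quotient_eq] at h
  simpa using h.symm

theorem exists_mem_eval_ne_zero {n : ℕ} {S : Set (Fin n → ℂ)} {c : MvPolynomial (Fin n) ℂ}
    (hc : c ∉ idealOf S) : ∃ x ∈ S, eval x c ≠ 0 := by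
  by_contra! h
  exact hc (mem_idealOf.2 h)

theorem fibre_subset_of_mem_irrCompsP {a b e : ℕ} {F : Fin b → MvPolynomial (Fin a) ℂ}
    {S D : Set (Fin a → ℂ)} (hD : D ∈ irrCompsP S) {y : Fin b → ℂ}
    (hS : (idealOf {x | x ∈ S ∧ (fun j => eval x (F j)) = y}).IsPrime)
    (he : quotientTrdeg (idealOf {x | x ∈ S ∧ (fun j => eval x (F j)) = y}) ≤ e)
    {t : Fin e → MvPolynomial (Fin a) ℂ}
    (ht : ∀ q : MvPolynomial (Fin e) ℂ,
      aeval t q ∈ idealOf {x | x ∈ D ∧ (fun j => eval x (F j)) = y} → q = 0) :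
    {x | x ∈ S ∧ (fun j => eval x (F j)) = y} ⊆ D := by
  have hle : idealOf {x | x ∈ S ∧ (fun j => eval x (F j)) = y} ≤
      idealOf {x | x ∈ D ∧ (fun j => eval x (F j)) = y} :=
    vanishingIdeal_anti_mono fun x hx => ⟨hD.1 hx.1, hx.2⟩
  have h := eq_of_quotientTrdeg_le hle ht he
  intro x hx
  refine mem_of_mem_irrCompsP hD hx.1 ?_
  have h1 := zeroLocus_vanishingIdeal_le (k := ℂ) _ hx
  change x ∈ zeroLocus ℂ (idealOf _) at h1
  rw [← h] at h1
  exact zeroLocus_anti_mono (vanishingIdeal_anti_mono fun x hx => hx.1) h1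

theorem exists_unique_irrCompsP_quotientTrdeg {a b d M : ℕ} {F : Fin b → MvPolynomial (Fin a) ℂ}
    {S : Set (Fin a → ℂ)} {Y : Set (Fin b → ℂ)} (hS : IsOpenInClosure S)
    (hmaps : ∀ x ∈ S, (fun j => eval x (F j)) ∈ Y)
    (hfib : ∀ y ∈ Y, isIrreducibleP {x | x ∈ S ∧ (fun j => eval x (F j)) = y} ∧
      quotientTrdeg (idealOf {x | x ∈ S ∧ (fun j => eval x (F j)) = y}) = d)
    {C : Set (Fin b → ℂ)} (hC : C ∈ irrCompsP Y) (hCM : quotientTrdeg (idealOf C) = M)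
    (hlt : ∀ D ∈ irrCompsP Y, D ≠ C → quotientTrdeg (idealOf D) < M) :
    ∃ D ∈ irrCompsP S, quotientTrdeg (idealOf D) = M + d ∧
      ∀ D' ∈ irrCompsP S, D' ≠ D → quotientTrdeg (idealOf D') < M + d := by
  have hfp (y) (hy : y ∈ Y) := isIrreducibleP_iff.1 (hfib y hy).1
  have himg {D : Set (Fin a → ℂ)} (hD : D ∈ irrCompsP S) :
      isIrreducibleP ((fun x j => eval x (F j)) '' D) := by
    have := isIrreducibleP_iff.1 hD.2.1
    rw [isIrreducibleP_iff, idealOf_image]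
    infer_instance
  have hsub {D : Set (Fin a → ℂ)} (hD : D ∈ irrCompsP S) :
      (fun x j => eval x (F j)) '' D ⊆ Y := by
    rintro _ ⟨x, hx, rfl⟩
    exact hmaps x (hD.1 hx)
  -- a component of `S` dominating `C`
  obtain ⟨s, hs, hsS⟩ := exists_finite_irrCompsP_cover S
  obtain ⟨D, hDs, hDle⟩ := hC.2.1.exists_idealOf_le s
    (fun D => {y | y ∈ C ∧ {x | x ∈ S ∧ (fun j => eval x (F j)) = y} ⊆ D}) (fun y hy => by
      obtain ⟨D, hD, h⟩ := exists_irrCompsP_of_irreducible_subset hs hsS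
        (fun x hx => hx.1) (hfib y (hC.1 hy)).1
      exact ⟨D, hD, hy, h⟩)
  have hD := hs D hDs
  have hID : idealOf ((fun x j => eval x (F j)) '' D) = idealOf C := by
    have h1 : idealOf ((fun x j => eval x (F j)) '' D) ≤ idealOf C := by
      refine le_trans (vanishingIdeal_anti_mono ?_) hDle
      rintro y ⟨hyC, hyD⟩
      obtain ⟨x, hx⟩ := (hfib y (hC.1 hyC)).1.1
      exact ⟨x, hyD hx, hx.2⟩
    obtain ⟨E, hE, hDE⟩ := exists_mem_irrCompsP_superset (hsub hD) (himg hD)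
    have hCE : C ⊆ E := fun y hy => mem_of_mem_irrCompsP hE (hC.1 hy)
      (zeroLocus_anti_mono ((vanishingIdeal_anti_mono hDE).trans h1)
        (zeroLocus_vanishingIdeal_le C hy))
    rw [hC.2.2 E hE.1 hE.2.1 hCE] at hDE
    exact h1.antisymm (vanishingIdeal_anti_mono hDE)
  obtain ⟨e, t, c, hc, he, hct⟩ := exists_generic_fibre F hD.2.1 (hS.of_mem_irrCompsP hD)
  rw [hID] at hc he hct
  obtain ⟨y, ⟨hyC, hyD⟩, hyc⟩ := exists_mem_eval_ne_zero fun h => hc (hDle h)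
  have hed : e = d := by
    obtain ⟨h1, h2⟩ := hct y (zeroLocus_vanishingIdeal_le C hyC) hyc
    have h3 : {x ∈ D | (fun j => eval x (F j)) = y} =
        {x | x ∈ S ∧ (fun j => eval x (F j)) = y} :=
      Set.Subset.antisymm (fun x hx => ⟨hD.1 hx.1, hx.2⟩) fun x hx => ⟨hyD hx, hx.2⟩
    rw [h3] at h1 h2
    have := hfp y (hC.1 hyC)
    rw [← (hfib y (hC.1 hyC)).2, quotientTrdeg_eq_of_generators h1 h2]
  subst hed
  refine ⟨D, hD, by rw [he, hCM], fun D' hD' hne => ?_⟩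
  obtain ⟨e', t', c', hc', he', hct'⟩ := exists_generic_fibre F hD'.2.1 (hS.of_mem_irrCompsP hD')
  obtain ⟨E, hE, hDE⟩ := exists_mem_irrCompsP_superset (hsub hD') (himg hD')
  have hip := isIrreducibleP_iff.1 (himg hD')
  have hEp := isIrreducibleP_iff.1 hE.2.1
  have hqE : quotientTrdeg (idealOf ((fun x j => eval x (F j)) '' D')) ≤
      quotientTrdeg (idealOf E) := quotientTrdeg_anti (vanishingIdeal_anti_mono hDE)
  have hEM : quotientTrdeg (idealOf E) ≤ M := by
    by_cases h : E = C
    · rw [h, hCM]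
    · exact (hlt E hE h).le
  have he'd : e' ≤ e := by
    obtain ⟨y, hy, hyc⟩ := exists_mem_eval_ne_zero hc'
    rw [← (hfib y (hsub hD' hy)).2]
    refine le_quotientTrdeg (t := t') fun q hq =>
      (hct' y (zeroLocus_vanishingIdeal_le _ hy) hyc).1 q ?_
    have hle : {x | x ∈ D' ∧ (fun j => eval x (F j)) = y} ⊆
        {x | x ∈ S ∧ (fun j => eval x (F j)) = y} := fun x hx => ⟨hD'.1 hx.1, hx.2⟩
    exact vanishingIdeal_anti_mono hle hq
  by_contra! hge
  obtain rfl : E = C := by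
    by_contra h
    have := hlt E hE h
    omega
  have hID' : idealOf ((fun x j => eval x (F j)) '' D') = idealOf E :=
    eq_of_le_of_quotientTrdeg_le (vanishingIdeal_anti_mono hDE) (by omega)
  apply hne
  refine (hD'.2.2 D hD.1 hD.2.1 fun x hx => ?_).symm
  refine mem_of_mem_irrCompsP hD (hD'.1 hx) fun p hp => ?_
  have hD'p := isIrreducibleP_iff.1 hD'.2.1
  have hcc : aeval F c ∉ idealOf D' := by
    rw [← Ideal.mem_comap, ← idealOf_image, hID']
    exact hc
  have hprod : aeval F c * p ∈ idealOf D' := by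
    rw [mem_idealOf]
    intro z hz
    rw [map_mul, eval_aeval_eq]
    by_contra h
    rw [← Ne, mul_ne_zero_iff] at h
    have hzE : (fun j => eval z (F j)) ∈ E := hDE ⟨z, hz, rfl⟩
    have hzY := hE.1 hzE
    have hzI := zeroLocus_vanishingIdeal_le (k := ℂ) E hzE
    exact h.2 (mem_idealOf.1 hp z (fibre_subset_of_mem_irrCompsP hD (hfp _ hzY)
      (hfib _ hzY).2.le (hct _ hzI h.1).1 ⟨hD'.1 hz, rfl⟩))
  exact mem_idealOf.1 ((hD'p.mem_or_mem hprod).resolve_left hcc) x hx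

theorem isOpenInClosure_fibre {a b : ℕ} (F : Fin b → MvPolynomial (Fin a) ℂ)
    {S : Set (Fin a → ℂ)} (hS : IsOpenInClosure S) (y : Fin b → ℂ) :
    IsOpenInClosure {x | x ∈ S ∧ (fun j => eval x (F j)) = y} := by
  refine hS.inter_zeroLocus (fun x hx => hx.1) fun x hx hxI => ⟨hx, funext fun j => ?_⟩
  have h : F j - C (y j) ∈ idealOf {x | x ∈ S ∧ (fun j => eval x (F j)) = y} := by
    rw [mem_idealOf]
    rintro z ⟨-, rfl⟩
    simp
  have := hxI _ h
  simpa [sub_eq_zero] using this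

end Zariski

/-- Let `X ⊆ ℂ^a`, `Y ⊆ ℂ^b` be nonempty locally closed subsets and
`f : X → Y` a surjective restriction of a polynomial map, all of whose fibres are
irreducible of dimension `d`. If `Y` has exactly one irreducible component of dimension `M`
and all others of strictly smaller dimension, then `X` has exactly one irreducible
component of dimension `M + d` and all others of strictly smaller dimension. -/
theorem stmt9 (a b : ℕ) (X : Set (Fin a → ℂ)) (Y : Set (Fin b → ℂ))
    (hXne : X.Nonempty) (hYne : Y.Nonempty)
    (hXlc : isLocallyClosedP X) (hYlc : isLocallyClosedP Y)
    (F : Fin b → MvPolynomial (Fin a) ℂ)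
    (f : (Fin a → ℂ) → (Fin b → ℂ))
    (hf : f = fun x j => MvPolynomial.eval x (F j))
    (hmaps : ∀ x ∈ X, f x ∈ Y)
    (hsurj : ∀ y ∈ Y, ∃ x ∈ X, f x = y)
    (d : ℕ)
    (hfib : ∀ y ∈ Y,
      isIrreducibleP {x | x ∈ X ∧ f x = y} ∧
      dimP {x | x ∈ X ∧ f x = y} = ((d : ℕ∞) : WithBot ℕ∞))
    (M : ℕ)
    (hY : ∃ C ∈ irrCompsP Y, dimP C = ((M : ℕ∞) : WithBot ℕ∞) ∧
      ∀ C' ∈ irrCompsP Y, C' ≠ C → dimP C' < ((M : ℕ∞) : WithBot ℕ∞)) :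
    ∃ C ∈ irrCompsP X, dimP C = (((M + d : ℕ) : ℕ∞) : WithBot ℕ∞) ∧
      ∀ C' ∈ irrCompsP X, C' ≠ C → dimP C' < (((M + d : ℕ) : ℕ∞) : WithBot ℕ∞) := by
  subst hf
  have hX := hXlc.isOpenInClosure
  have hYo := hYlc.isOpenInClosure
  obtain ⟨C, hC, hCM, hlt⟩ := hY
  have hdim {n m : ℕ} {S T : Set (Fin n → ℂ)} (hS : IsOpenInClosure S) (hT : T ∈ irrCompsP S) :
      dimP T = ((m : ℕ∞) : WithBot ℕ∞) ↔ quotientTrdeg (idealOf T) = m := by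
    rw [dimP_eq hT.2.1 (hS.of_mem_irrCompsP hT)]
    norm_cast
  have hdim' {n m : ℕ} {S T : Set (Fin n → ℂ)} (hS : IsOpenInClosure S) (hT : T ∈ irrCompsP S) :
      dimP T < ((m : ℕ∞) : WithBot ℕ∞) ↔ quotientTrdeg (idealOf T) < m := by
    rw [dimP_eq hT.2.1 (hS.of_mem_irrCompsP hT)]
    norm_cast
  obtain ⟨D, hD, hDd, h⟩ := exists_unique_irrCompsP_quotientTrdeg (d := d) hX hmaps
    (fun y hy => ⟨(hfib y hy).1, by
      have h := (hfib y hy).2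
      rw [dimP_eq (hfib y hy).1 (isOpenInClosure_fibre F hX y)] at h
      exact_mod_cast h⟩) hC ((hdim hYo hC).1 hCM)
    fun E hE hne => (hdim' hYo hE).1 (hlt E hE hne)
  exact ⟨D, hD, (hdim hX hD).2 hDd, fun E hE hne => (hdim' hX hE).2 (h E hE hne)⟩

end GovNine

end
end

section
/- In the polynomial ring ℂ[a_1, …, a_{10}], the ideal generated by the five polynomials a_5, a_{10}, a_1 a_6 + a_2 a_8, a_7 a_8 − a_6 a_9, a_1 a_7 + a_2 a_9 is a prime ideal. -/
open MvPolynomial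

section TwoByThree

variable {Q : Type*} [CommRing Q]

/-- The product `∏ aᵢ ^ αᵢ * bᵢ ^ (wᵢ - αᵢ)` where `α` distributes the total degree `p` greedily
over the columns of widths `w₀, w₁, w₂`. -/
def standardProduct (a₀ a₁ a₂ b₀ b₁ b₂ : Q) (p w₀ w₁ w₂ : ℕ) : Q :=
  a₀ ^ min p w₀ * b₀ ^ (w₀ - p) * (a₁ ^ min (p - w₀) w₁ * b₁ ^ (w₁ - (p - w₀))) *
    (a₂ ^ min (p - w₀ - w₁) w₂ * b₂ ^ (w₂ - (p - w₀ - w₁)))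

/-- Straightening: modulo the `2 × 2` minors of a `2 × 3` matrix every monomial in its entries is
equal to the standard one with the same row and column degrees. -/
theorem standardProduct_eq {a₀ a₁ a₂ b₀ b₁ b₂ : Q} (h₀₁ : a₀ * b₁ = a₁ * b₀)
    (h₀₂ : a₀ * b₂ = a₂ * b₀) (h₁₂ : a₁ * b₂ = a₂ * b₁) (i j k l m n : ℕ) :
    standardProduct a₀ a₁ a₂ b₀ b₁ b₂ (i + j + k) (i + l) (j + m) (k + n) =
      a₀ ^ i * b₀ ^ l * (a₁ ^ j * b₁ ^ m) * (a₂ ^ k * b₂ ^ n) := by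
  have e₀₁ (r : ℕ) : a₀ ^ r * b₁ ^ r = a₁ ^ r * b₀ ^ r := by rw [← mul_pow, h₀₁, mul_pow]
  have e₀₂ (r : ℕ) : a₀ ^ r * b₂ ^ r = a₂ ^ r * b₀ ^ r := by rw [← mul_pow, h₀₂, mul_pow]
  have e₁₂ (r : ℕ) : a₁ ^ r * b₂ ^ r = a₂ ^ r * b₁ ^ r := by rw [← mul_pow, h₁₂, mul_pow]
  unfold standardProduct
  rcases le_total (j + k) l with h | h
  · obtain ⟨r, rfl⟩ := Nat.exists_eq_add_of_le h
    rw [show min (i + j + k) (i + (j + k + r)) = i + j + k by omega,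
      show i + (j + k + r) - (i + j + k) = r by omega,
      show i + j + k - (i + (j + k + r)) = 0 by omega]
    simp only [Nat.zero_sub, Nat.zero_min, Nat.sub_zero, pow_zero, one_mul]
    calc _ = a₀ ^ i * b₀ ^ r * b₁ ^ m * b₂ ^ n * (a₀ ^ j * b₁ ^ j) * (a₀ ^ k * b₂ ^ k) := by ring
      _ = _ := by rw [e₀₁, e₀₂]; ring
  · rw [show min (i + j + k) (i + l) = i + l by omega,
      show i + l - (i + j + k) = 0 by omega,
      show i + j + k - (i + l) = j + k - l by omega]
    rcases le_total k (l + m) with h' | h'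
    · rw [show min (j + k - l) (j + m) = j + k - l by omega,
        show j + k - l - (j + m) = 0 by omega]
      simp only [Nat.zero_min, Nat.sub_zero, pow_zero, one_mul, mul_one]
      rcases le_total l k with h'' | h''
      · obtain ⟨r, rfl⟩ := Nat.exists_eq_add_of_le h''
        obtain ⟨t, rfl⟩ := Nat.exists_eq_add_of_le (show r ≤ m by omega)
        rw [show j + (l + r) - l = j + r by omega, show j + (r + t) - (j + r) = t by omega]
        calc _ = a₀ ^ i * a₁ ^ j * b₁ ^ t * b₂ ^ n * (a₀ ^ l * b₂ ^ l) * (a₁ ^ r * b₂ ^ r) := by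
              ring
          _ = _ := by rw [e₀₂, e₁₂]; ring
      · obtain ⟨r, rfl⟩ := Nat.exists_eq_add_of_le h''
        obtain ⟨t, rfl⟩ := Nat.exists_eq_add_of_le (show r ≤ j by omega)
        rw [show r + t + k - (k + r) = t by omega, show r + t + m - t = r + m by omega]
        calc _ = a₀ ^ i * a₁ ^ t * b₁ ^ m * b₂ ^ n * (a₀ ^ k * b₂ ^ k) * (a₀ ^ r * b₁ ^ r) := by
              ring
          _ = _ := by rw [e₀₂, e₀₁]; ring
    · obtain ⟨r, rfl⟩ := Nat.exists_eq_add_of_le h'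
      rw [show min (j + (l + m + r) - l) (j + m) = j + m by omega,
        show j + m - (j + (l + m + r) - l) = 0 by omega,
        show j + (l + m + r) - l - (j + m) = r by omega,
        show min r (l + m + r + n) = r by omega,
        show l + m + r + n - r = l + m + n by omega]
      calc _ = a₀ ^ i * a₁ ^ j * a₂ ^ r * b₂ ^ n * (a₀ ^ l * b₂ ^ l) * (a₁ ^ m * b₂ ^ m) := by ring
        _ = _ := by rw [e₀₂, e₁₂]; ring

end TwoByThree

/-- Parametrization of the variety by rank-one `2 × 3` matrices `(s, t)ᵀ (u₀, u₁, u₂)` and two free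
coordinates, with `s, t, u₀, u₁, u₂` the first five variables of the target. -/
noncomputable def rankOneParam : MvPolynomial (Fin 10) ℂ →ₐ[ℂ] MvPolynomial (Fin 7) ℂ :=
  aeval ![X 0 * X 2, -(X 1 * X 2), X 5, X 6, 0, X 1 * X 3, X 1 * X 4, X 0 * X 3, X 0 * X 4, 0]

/-- An algebra map satisfying the given equations factors linearly through `rankOneParam`. -/
theorem ker_rankOneParam_le {Q : Type*} [CommRing Q] [Algebra ℂ Q]
    (f : MvPolynomial (Fin 10) ℂ →ₐ[ℂ] Q) (h4 : f (X 4) = 0) (h9 : f (X 9) = 0)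
    (h₀₁ : f (X 0 * X 5 + X 1 * X 7) = 0) (h₁₂ : f (X 6 * X 7 - X 5 * X 8) = 0)
    (h₀₂ : f (X 0 * X 6 + X 1 * X 8) = 0) :
    RingHom.ker rankOneParam ≤ RingHom.ker f := by
  simp only [map_add, map_sub, map_mul] at h₀₁ h₁₂ h₀₂
  let N : MvPolynomial (Fin 7) ℂ →ₗ[ℂ] Q := (basisMonomials (Fin 7) ℂ).constr ℂ fun e ↦
    standardProduct (f (X 0)) (f (X 7)) (f (X 8)) (-f (X 1)) (f (X 5)) (f (X 6))
      (e 0) (e 2) (e 3) (e 4) * (f (X 2) ^ e 5 * f (X 3) ^ e 6)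
  have hN (e : Fin 7 →₀ ℕ) : N (monomial e 1) =
      standardProduct (f (X 0)) (f (X 7)) (f (X 8)) (-f (X 1)) (f (X 5)) (f (X 6))
        (e 0) (e 2) (e 3) (e 4) * (f (X 2) ^ e 5 * f (X 3) ^ e 6) := by
    exact (basisMonomials (Fin 7) ℂ).constr_basis ℂ _ e
  have key : N ∘ₗ rankOneParam.toLinearMap = f.toLinearMap := by
    refine (basisMonomials (Fin 10) ℂ).ext fun d ↦ ?_
    have hd : monomial d (1 : ℂ) = X 0 ^ d 0 * X 1 ^ d 1 * X 2 ^ d 2 * X 3 ^ d 3 * X 4 ^ d 4 *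
        X 5 ^ d 5 * X 6 ^ d 6 * X 7 ^ d 7 * X 8 ^ d 8 * X 9 ^ d 9 := by
      rw [monomial_eq, C_1, one_mul, Finsupp.prod_fintype _ _ fun i ↦ pow_zero _,
        Fin.prod_univ_castSucc, Fin.prod_univ_castSucc, Fin.prod_univ_eight]
      rfl
    simp only [coe_basisMonomials, LinearMap.comp_apply, AlgHom.toLinearMap_apply]
    by_cases h : d 4 = 0 ∧ d 9 = 0
    · let e : Fin 7 →₀ ℕ := Finsupp.equivFunOnFinite.symm
        ![d 0 + d 7 + d 8, d 1 + d 5 + d 6, d 0 + d 1, d 7 + d 5, d 8 + d 6, d 2, d 3]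
      have he : rankOneParam (monomial d 1) = (-1 : ℂ) ^ d 1 • monomial e 1 := by
        rw [hd, monomial_eq, C_1, one_mul, Finsupp.prod_fintype _ _ fun i ↦ pow_zero _,
          Fin.prod_univ_seven]
        simp [rankOneParam, e, h, smul_eq_C_mul]
        ring
      have hs := standardProduct_eq (a₀ := f (X 0)) (a₁ := f (X 7)) (a₂ := f (X 8))
        (b₀ := -f (X 1)) (b₁ := f (X 5)) (b₂ := f (X 6)) (by linear_combination h₀₁)
        (by linear_combination h₀₂) (by linear_combination h₁₂) (d 0) (d 7) (d 8) (d 1) (d 5) (d 6)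
      rw [he, map_smul, hN]
      change (-1 : ℂ) ^ d 1 • (standardProduct _ _ _ _ _ _ (d 0 + d 7 + d 8) (d 0 + d 1)
        (d 7 + d 5) (d 8 + d 6) * (f (X 2) ^ d 2 * f (X 3) ^ d 3)) = _
      rw [hs, hd, Algebra.smul_def, neg_pow (f (X 1))]
      simp only [map_mul, map_pow, map_neg, map_one, h, pow_zero, mul_one]
      have hsq : ((-1 : Q) ^ d 1) * (-1) ^ d 1 = 1 := by rw [← mul_pow]; simp
      linear_combination (f (X 0) ^ d 0 * f (X 1) ^ d 1 * f (X 2) ^ d 2 * f (X 3) ^ d 3 *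
        f (X 5) ^ d 5 * f (X 6) ^ d 6 * f (X 7) ^ d 7 * f (X 8) ^ d 8) * hsq
    · have hz : rankOneParam (X 4) = 0 ∧ rankOneParam (X 9) = 0 := by simp [rankOneParam]
      rw [hd]
      simp only [map_mul, map_pow, hz, h4, h9]
      rcases not_and_or.1 h with h | h <;> simp [zero_pow h]
  intro p hp
  rw [RingHom.mem_ker] at hp ⊢
  have := LinearMap.congr_fun key p
  simpa [hp] using this.symm

/-- In `ℂ[a_1, …, a_{10}]` (with `a_i = X (i-1)`), the ideal generated by
`a_5`, `a_{10}`, `a_1 a_6 + a_2 a_8`, `a_7 a_8 − a_6 a_9`, `a_1 a_7 + a_2 a_9` is prime. -/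
theorem stmt14 :
    (Ideal.span
      ({ X 4, X 9,
         X 0 * X 5 + X 1 * X 7,
         X 6 * X 7 - X 5 * X 8,
         X 0 * X 6 + X 1 * X 8 } :
        Set (MvPolynomial (Fin 10) ℂ))).IsPrime := by
  set I := Ideal.span ({ X 4, X 9, X 0 * X 5 + X 1 * X 7, X 6 * X 7 - X 5 * X 8,
    X 0 * X 6 + X 1 * X 8 } : Set (MvPolynomial (Fin 10) ℂ)) with hI
  suffices h : I = RingHom.ker rankOneParam from h ▸ RingHom.ker_isPrime _
  apply le_antisymm
  · rw [hI, Ideal.span_le]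
    rintro _ (rfl | rfl | rfl | rfl | rfl) <;>
      simp only [SetLike.mem_coe, RingHom.mem_ker, rankOneParam, map_add, map_sub, map_mul,
        aeval_X] <;> simp <;> ring
  · have hm {q} (hq : q ∈ ({ X 4, X 9, X 0 * X 5 + X 1 * X 7, X 6 * X 7 - X 5 * X 8,
        X 0 * X 6 + X 1 * X 8 } : Set (MvPolynomial (Fin 10) ℂ))) :
        Ideal.Quotient.mkₐ ℂ I q = 0 := Ideal.Quotient.eq_zero_iff_mem.2 (Ideal.subset_span hq)
    refine (ker_rankOneParam_le (Ideal.Quotient.mkₐ ℂ I) (hm ?_) (hm ?_) (hm ?_) (hm ?_)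
      (hm ?_)).trans_eq (Ideal.Quotient.mkₐ_ker ℂ I) <;> simp
end

section
/- In the polynomial ring ℂ[a_1, …, a_{15}], the ideal generated by the twelve polynomials a_{15}, a_{10}, a_1, a_6 a_{11} + a_7 a_{13}, a_{12} a_{13} − a_{11} a_{14}, a_6 a_{12} + a_7 a_{14}, a_2 a_{11} + a_3 a_{13}, a_3 a_6 − a_2 a_7, a_2 a_{12} + a_3 a_{14}, a_5 a_6 a_{13} − a_2 a_9 a_{13} − a_4 a_6 a_{14} + a_2 a_8 a_{14}, a_5 a_7 a_{13} − a_3 a_9 a_{13} − a_4 a_7 a_{14} + a_3 a_8 a_{14}, a_5 a_7 a_{11} − a_3 a_9 a_{11} − a_4 a_7 a_{12} + a_3 a_8 a_{12} is a prime ideal. -/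
open MvPolynomial

section RankOne

variable {B ι : Type*} [CommRing B]

/-- If all `2 × 2` minors of the matrix with rows `u` and `v` vanish, a product of entries depends
only on how many are taken from each row and on the multiset of columns used. -/
lemma prod_map_mul_prod_map_eq {u v : ι → B} (huv : ∀ i j, u i * v j = u j * v i)
    (a' b' a b : Multiset ι) (h : a + b = a' + b') (hc : a.card = a'.card) :
    (a.map u).prod * (b.map v).prod = (a'.map u).prod * (b'.map v).prod := by
  classical
  induction a' using Multiset.induction_on generalizing a b with
  | empty =>
    obtain rfl : a = 0 := by simpa using hc
    simp_all
  | cons j a' ih =>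
    by_cases hj : j ∈ a
    · obtain ⟨a₁, rfl⟩ := Multiset.exists_cons_of_mem hj
      have := ih a₁ b (by simpa using h) (by simpa using hc)
      simp only [Multiset.map_cons, Multiset.prod_cons, mul_assoc, this]
    · have hjb : j ∈ b := by
        have : j ∈ a + b := by simp [h]
        simpa [hj] using this
      obtain ⟨b₁, rfl⟩ := Multiset.exists_cons_of_mem hjb
      obtain ⟨i, hi⟩ : ∃ i, i ∈ a := Multiset.card_pos_iff_exists_mem.1 (by simp [hc])
      obtain ⟨a₁, rfl⟩ := Multiset.exists_cons_of_mem hi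
      have := ih a₁ (i ::ₘ b₁) (by
        rw [Multiset.add_cons, Multiset.cons_add, Multiset.cons_add] at h
        rw [Multiset.add_cons]
        exact (Multiset.cons_inj_right j).1 (by rw [← h, Multiset.cons_swap])) (by simpa using hc)
      simp only [Multiset.map_cons, Multiset.prod_cons] at this ⊢
      linear_combination u j * this + (a₁.map u).prod * (b₁.map v).prod * huv i j

/-- For a `2 × n` matrix with vanishing `2 × 2` minors there is a coherent choice of the product of
`a` entries of the first row and `b` entries of the second row with a prescribed multiset of
columns. -/
lemma exists_balanced_prod {u v : ι → B} (huv : ∀ i j, u i * v j = u j * v i) :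
    ∃ S : ℕ × ℕ × Multiset ι → B, S 0 = 1 ∧
      (∀ a b m i, S (a + 1, b, i ::ₘ m) = u i * S (a, b, m)) ∧
      (∀ a b m i, S (a, b + 1, i ::ₘ m) = v i * S (a, b, m)) ∧
      ∀ a b m, m.card ≠ a + b → S (a, b, m) = 0 := by
  classical
  let P : ℕ × ℕ × Multiset ι → Multiset ι × Multiset ι → Prop :=
    fun x y ↦ y.1 + y.2 = x.2.2 ∧ y.1.card = x.1 ∧ y.2.card = x.2.1
  let S : ℕ × ℕ × Multiset ι → B := fun x ↦
    if h : ∃ y, P x y then (h.choose.1.map u).prod * (h.choose.2.map v).prod else 0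
  have hS (s t : Multiset ι) :
      S (s.card, t.card, s + t) = (s.map u).prod * (t.map v).prod := by
    have h : ∃ y, P (s.card, t.card, s + t) y := ⟨(s, t), rfl, rfl, rfl⟩
    simp only [S, dif_pos h]
    exact prod_map_mul_prod_map_eq huv _ _ _ _ h.choose_spec.1 h.choose_spec.2.1
  have hS0 (a b m) (h : m.card ≠ a + b) : S (a, b, m) = 0 := by
    refine dif_neg ?_
    rintro ⟨y, h₁, h₂, h₃⟩
    exact h (by simp only at h₁ h₂ h₃; rw [← h₁, Multiset.card_add, h₂, h₃])
  have split (a b : ℕ) (m : Multiset ι) (h : m.card = a + b) :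
      ∃ s t : Multiset ι, s.card = a ∧ t.card = b ∧ s + t = m := by
    obtain ⟨s, hs⟩ : ∃ s, s ∈ Multiset.powersetCard a m :=
      Multiset.card_pos_iff_exists_mem.1 (by
        rw [Multiset.card_powersetCard]; exact Nat.choose_pos (by omega))
    obtain ⟨hle, rfl⟩ := Multiset.mem_powersetCard.1 hs
    exact ⟨s, m - s, rfl, by rw [Multiset.card_sub hle]; omega, add_tsub_cancel_of_le hle⟩
  refine ⟨S, (hS 0 0).trans (by simp), fun a b m i ↦ ?_, fun a b m i ↦ ?_, hS0⟩
  · by_cases h : m.card = a + b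
    · obtain ⟨s, t, rfl, rfl, rfl⟩ := split a b m h
      simpa [mul_assoc, hS] using hS (i ::ₘ s) t
    · rw [hS0 _ _ _ h, hS0 _ _ _ (by simp; omega), mul_zero]
  · by_cases h : m.card = a + b
    · obtain ⟨s, t, rfl, rfl, rfl⟩ := split a b m h
      simpa [mul_left_comm, hS] using hS s (i ::ₘ t)
    · rw [hS0 _ _ _ h, hS0 _ _ _ (by simp; omega), mul_zero]

/-- A rank one matrix with rows `u` and `v` gives a linear retraction of the Segre parametrization
`u i = s x_i`, `v i = t x_i`, where `s ^ a * t ^ b * ∏ x_i` is the element `single (a, b, m) 1`. -/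
lemma exists_segre_retraction {u v : ι → B} (huv : ∀ i j, u i * v j = u j * v i) :
    ∃ σ : AddMonoidAlgebra B (ℕ × ℕ × Multiset ι) →+ B, σ 1 = 1 ∧
      (∀ r p, σ (.single 0 r * p) = r * σ p) ∧
      (∀ i p, σ (.single (1, 0, {i}) 1 * p) = u i * σ p) ∧
      (∀ i p, σ (.single (0, 1, {i}) 1 * p) = v i * σ p) ∧
      ∀ a b m r, m.card ≠ a + b → σ (.single (a, b, m) r) = 0 := by
  obtain ⟨S, h1, hu, hv, h0⟩ := exists_balanced_prod huv
  let σ : AddMonoidAlgebra B (ℕ × ℕ × Multiset ι) →+ B :=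
    (Finsupp.linearCombination B S).toAddMonoidHom.comp
      (AddMonoidAlgebra.coeffAddEquiv (R := B)).toAddMonoidHom
  have hσ (m r) : σ (.single m r) = r * S m := by
    change Finsupp.linearCombination B S (Finsupp.single m r) = _
    simp
  refine ⟨σ, ?_, fun r p ↦ ?_, fun i p ↦ ?_, fun i p ↦ ?_, fun a b m r h ↦ ?_⟩
  · rw [AddMonoidAlgebra.one_def, hσ, h1, one_mul]
  · induction p using AddMonoidAlgebra.induction_linear with
    | zero => simp
    | add p q hp hq => simp only [mul_add, map_add, hp, hq]
    | single m c => rw [AddMonoidAlgebra.single_mul_single, zero_add, hσ, hσ, mul_assoc]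
  · induction p using AddMonoidAlgebra.induction_linear with
    | zero => simp
    | add p q hp hq => simp only [mul_add, map_add, hp, hq]
    | single m c =>
      obtain ⟨a, b, m⟩ := m
      rw [AddMonoidAlgebra.single_mul_single, hσ, hσ, one_mul, mul_left_comm, ← hu, ← Multiset.singleton_add]
      simp [add_comm]
  · induction p using AddMonoidAlgebra.induction_linear with
    | zero => simp
    | add p q hp hq => simp only [mul_add, map_add, hp, hq]
    | single m c =>
      obtain ⟨a, b, m⟩ := m
      rw [AddMonoidAlgebra.single_mul_single, hσ, hσ, one_mul, mul_left_comm, ← hv, ← Multiset.singleton_add]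
      simp [add_comm]
  · rw [hσ, h0 _ _ _ h, mul_zero]

end RankOne

/-- With `s, t` the variables `0, 1`, `x_1, …, x_4` the variables `2, …, 5`, and `y_1, …, y_4` the
variables `6, …, 9`, the parametrization of the cone over the Segre variety `ℙ¹ × ℙ³`. -/
noncomputable def segreParam : MvPolynomial (Fin 15) ℂ →ₐ[ℂ] MvPolynomial (Fin 10) ℂ :=
  aeval ![0, X 0 * X 2, X 1 * X 2, X 6, X 7, X 0 * X 3, X 1 * X 3, X 8, X 9, 0,
    -(X 1 * X 4), -(X 1 * X 5), X 0 * X 4, X 0 * X 5, 0]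

/-- The quadric in `x`, with coefficients linear in `y`, cutting out the variety inside the Segre
cone. -/
noncomputable def segreDivisor : MvPolynomial (Fin 10) ℂ :=
  X 3 * X 4 * X 7 + (X 2 * X 5 * X 8 - X 2 * X 4 * X 9 - X 3 * X 5 * X 6)

lemma prime_segreDivisor : Prime segreDivisor := by
  have hX (i : Fin 10) (g : MvPolynomial (Fin 10) ℂ) (f : Fin 10 → ℂ) (hf : f i = 0)
      (hg : eval f g ≠ 0) : IsRelPrime (X i) g := by
    refine (X_prime (R := ℂ) (i := i)).irreducible.isRelPrime_iff_not_dvd.2 ?_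
    rintro ⟨h, rfl⟩
    simp [hf] at hg
  refine Irreducible.prime (irreducible_mul_X_add _ _ _ ?_ ?_ ?_ ?_)
  · exact mul_ne_zero (X_ne_zero _) (X_ne_zero _)
  · intro h
    have := vars_mul _ _ h
    simp at this
  · intro h
    have mul3 (i j k : Fin 10) (hm : 7 ∈ (X i * X j * X k : MvPolynomial (Fin 10) ℂ).vars) :
        7 = i ∨ 7 = j ∨ 7 = k := by
      have h₁ := vars_mul _ _ hm
      rw [Finset.mem_union] at h₁
      rcases h₁ with h₁ | h₁
      · have h₂ := vars_mul _ _ h₁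
        simp at h₂
        tauto
      · simp at h₁
        tauto
    have h₁ := vars_sub_subset _ h
    rw [Finset.mem_union] at h₁
    rcases h₁ with h₁ | h₁
    · have h₂ := vars_sub_subset _ h₁
      rw [Finset.mem_union] at h₂
      rcases h₂ with h₂ | h₂ <;> simpa using mul3 _ _ _ h₂
    · simpa using mul3 _ _ _ h₁
  · refine IsRelPrime.mul_left (hX _ _ ![1, 1, 1, 0, 1, 1, 1, 1, 1, 0] rfl ?_)
      (hX _ _ ![1, 1, 1, 1, 0, 1, 0, 1, 1, 1] rfl ?_) <;> simp

/-- A point `x` of the variety, valued in any `ℂ`-algebra, kills every polynomial whose pullback to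
the Segre cone is divisible by `segreDivisor`. -/
lemma aeval_eq_zero_of_segreDivisor_dvd {B : Type*} [CommRing B] [Algebra ℂ B] {x : Fin 15 → B}
    (e14 : x 14 = 0) (e9 : x 9 = 0) (e0 : x 0 = 0)
    (m₁ : x 5 * x 10 + x 6 * x 12 = 0) (m₂ : x 11 * x 12 - x 10 * x 13 = 0)
    (m₃ : x 5 * x 11 + x 6 * x 13 = 0) (m₄ : x 1 * x 10 + x 2 * x 12 = 0)
    (m₅ : x 2 * x 5 - x 1 * x 6 = 0) (m₆ : x 1 * x 11 + x 2 * x 13 = 0)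
    (c₁ : x 4 * x 5 * x 12 - x 1 * x 8 * x 12 - x 3 * x 5 * x 13 + x 1 * x 7 * x 13 = 0)
    (c₂ : x 4 * x 6 * x 12 - x 2 * x 8 * x 12 - x 3 * x 6 * x 13 + x 2 * x 7 * x 13 = 0)
    (c₃ : x 4 * x 6 * x 10 - x 2 * x 8 * x 10 - x 3 * x 6 * x 11 + x 2 * x 7 * x 11 = 0)
    {F : MvPolynomial (Fin 15) ℂ} (hF : segreDivisor ∣ segreParam F) : aeval x F = 0 := by
  have huv (i j : Fin 4) : ![x 1, x 5, x 12, x 13] i * ![x 2, x 6, -x 10, -x 11] j =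
      ![x 1, x 5, x 12, x 13] j * ![x 2, x 6, -x 10, -x 11] i := by
    fin_cases i <;> fin_cases j <;> simp <;> grind
  obtain ⟨σ, h1, hC, hu, hv, h0⟩ := exists_segre_retraction huv
  let e (m : ℕ × ℕ × Multiset (Fin 4)) (r : B) :
    AddMonoidAlgebra B (ℕ × ℕ × Multiset (Fin 4)) := .single m r
  have he (m m' r r') : e m r * e m' r' = e (m + m') (r * r') :=
    AddMonoidAlgebra.single_mul_single ..
  let θ : MvPolynomial (Fin 10) ℂ →ₐ[ℂ] AddMonoidAlgebra B (ℕ × ℕ × Multiset (Fin 4)) :=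
    aeval ![e (1, 0, 0) 1, e (0, 1, 0) 1, e (0, 0, {0}) 1, e (0, 0, {1}) 1, e (0, 0, {2}) 1,
      e (0, 0, {3}) 1, e 0 (x 3), e 0 (x 4), e 0 (x 7), e 0 (x 8)]
  have hθ (F) : ∀ p, σ (θ (segreParam F) * p) = aeval x F * σ p := by
    induction F using MvPolynomial.induction_on with
    | C a =>
      intro p
      rw [← algebraMap_eq, AlgHom.commutes, AlgHom.commutes, AlgHom.commutes]
      exact hC _ p
    | add F F' h h' => intro p; simp only [map_add, add_mul, h, h']
    | mul_X F i h =>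
      intro p
      rw [map_mul segreParam, map_mul θ, map_mul (aeval x), mul_assoc, h, mul_assoc, aeval_X]
      congr 1
      fin_cases i <;>
        simp [segreParam, θ, e, AddMonoidAlgebra.single_mul_single, hC, hu, hv, e14, e9, e0]
  have hrel {c : MvPolynomial (Fin 15) ℂ} (hc : aeval x c = 0) {f : MvPolynomial (Fin 10) ℂ}
      (hf : segreParam c = segreDivisor * f) (p) : σ (θ segreDivisor * (θ f * p)) = 0 := by
    rw [← mul_assoc, ← map_mul, ← hf, hθ, hc, zero_mul]
  have hq (p) : σ (θ segreDivisor * p) = 0 := by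
    induction p using AddMonoidAlgebra.induction_linear with
    | zero => simp
    | add p q hp hq => simp only [mul_add, map_add, hp, hq, add_zero]
    | single m r =>
      obtain ⟨a, b, m⟩ := m
      change σ (θ segreDivisor * e (a, b, m) r) = 0
      obtain ⟨a, rfl⟩ | ⟨⟨a, rfl⟩, b, rfl⟩ | ⟨b, rfl⟩ | hab :
          (∃ a', a = 2 + a') ∨ ((∃ a', a = 1 + a') ∧ ∃ b', b = 1 + b') ∨ (∃ b', b = 2 + b') ∨
            a + b < 2 := by
        simp only [← le_iff_exists_add]
        omega
      · have := hrel (c := X 4 * X 5 * X 12 - X 1 * X 8 * X 12 - X 3 * X 5 * X 13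
          + X 1 * X 7 * X 13) (f := X 0 * X 0) (by simpa using c₁)
          (by simp [segreParam, segreDivisor]; ring) (e (a, b, m) r)
        simpa [θ, he, add_assoc] using this
      · have := hrel (c := X 4 * X 6 * X 12 - X 2 * X 8 * X 12 - X 3 * X 6 * X 13
          + X 2 * X 7 * X 13) (f := X 0 * X 1) (by simpa using c₂)
          (by simp [segreParam, segreDivisor]; ring) (e (a, b, m) r)
        simpa [θ, he, add_assoc] using this
      · have := hrel (c := X 4 * X 6 * X 10 - X 2 * X 8 * X 10 - X 3 * X 6 * X 11
          + X 2 * X 7 * X 11) (f := -(X 1 * X 1)) (by simpa using c₃)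
          (by simp [segreParam, segreDivisor]; ring) (e (a, b, m) r)
        simpa [θ, he, add_assoc] using this
      · have hσ (i j : Fin 4) (r) : σ (e ((0, 0, {i}) + (0, 0, {j}) + (a, b, m)) r) = 0 :=
          h0 _ _ _ _ (by simp; omega)
        simp only [segreDivisor, θ, map_add, map_sub, map_mul, aeval_X]
        simp [he, add_mul, sub_mul] at hσ ⊢
        simp [hσ]
  obtain ⟨G, hG⟩ := hF
  rw [← mul_one (aeval x F), ← h1, ← hθ, hG, map_mul θ, mul_assoc, hq]

/-- In `ℂ[a_1, …, a_{15}]` (with `a_i = X (i-1)`), the ideal generated by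
the twelve listed polynomials is prime. -/
theorem stmt15 :
    (Ideal.span
      ({ X 14, X 9, X 0,
         X 5 * X 10 + X 6 * X 12,
         X 11 * X 12 - X 10 * X 13,
         X 5 * X 11 + X 6 * X 13,
         X 1 * X 10 + X 2 * X 12,
         X 2 * X 5 - X 1 * X 6,
         X 1 * X 11 + X 2 * X 13,
         X 4 * X 5 * X 12 - X 1 * X 8 * X 12 - X 3 * X 5 * X 13 + X 1 * X 7 * X 13,
         X 4 * X 6 * X 12 - X 2 * X 8 * X 12 - X 3 * X 6 * X 13 + X 2 * X 7 * X 13,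
         X 4 * X 6 * X 10 - X 2 * X 8 * X 10 - X 3 * X 6 * X 11 + X 2 * X 7 * X 11 } :
        Set (MvPolynomial (Fin 15) ℂ))).IsPrime := by
  set I : Ideal (MvPolynomial (Fin 15) ℂ) := Ideal.span _ with hI
  have hprime : (Ideal.span {segreDivisor}).IsPrime :=
    (Ideal.span_singleton_prime prime_segreDivisor.ne_zero).2 prime_segreDivisor
  suffices I = (Ideal.span {segreDivisor}).comap segreParam by
    rw [this]
    exact hprime.comap _
  apply le_antisymm
  · rw [hI, Ideal.span_le]
    simp only [Set.insert_subset_iff, Set.singleton_subset_iff, SetLike.mem_coe, Ideal.mem_comap,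
      Ideal.mem_span_singleton, segreDivisor, segreParam, map_add, map_sub, map_mul, aeval_X]
    refine ⟨⟨0, ?_⟩, ⟨0, ?_⟩, ⟨0, ?_⟩, ⟨0, ?_⟩, ⟨0, ?_⟩, ⟨0, ?_⟩, ⟨0, ?_⟩, ⟨0, ?_⟩, ⟨0, ?_⟩,
      ⟨X 0 ^ 2, ?_⟩, ⟨X 0 * X 1, ?_⟩, ⟨-X 1 ^ 2, ?_⟩⟩ <;> simp <;> ring
  · intro F hF
    have hmk : Ideal.Quotient.mkₐ ℂ I = aeval fun i ↦ Ideal.Quotient.mk I (X i) := by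
      ext i
      simp
    have mk0 {p : MvPolynomial (Fin 15) ℂ} (hp : p ∈ I) : Ideal.Quotient.mk I p = 0 :=
      Ideal.Quotient.eq_zero_iff_mem.2 hp
    rw [← Ideal.Quotient.eq_zero_iff_mem, ← Ideal.Quotient.mkₐ_eq_mk ℂ, hmk]
    refine aeval_eq_zero_of_segreDivisor_dvd ?_ ?_ ?_ ?_ ?_ ?_ ?_ ?_ ?_ ?_ ?_ ?_
      (Ideal.mem_span_singleton.1 (Ideal.mem_comap.1 hF)) <;>
      exact mk0 (Ideal.subset_span (by simp))
end
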